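/- arXiv:1903.08476 — 2 statements merged into one kernel-verified Lean document; each statement's English description precedes it below -/
import Mathlib

section
/- Let T be a triangle in the plane. The image of the subspace H^{5/2}(T) of H^2(T) under the trace operator Tr is exactly the space (H^2×H^1)(∂T); i.e., a pair (f,g) ∈ H^2(∂T)×H^1(∂T) arises as (ζ, ∂ζ/∂n)|_{∂T} for some ζ ∈ H^{5/2}(T) if and only if (f,g) satisfies the compatibility conditions defining (H^2×H^1)(∂T). -/
open MeasureTheory Real Set
open scoped RealInnerProductSpace
noncomputable section

abbrev E2 := EuclideanSpace ℝ (Fin 2)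
def stdb2 (i : Fin 2) : E2 := EuclideanSpace.single i 1
def L2on {n : ℕ} (Ω : Set (EuclideanSpace ℝ (Fin n))) (u : EuclideanSpace ℝ (Fin n) → ℝ) : Prop :=
  MemLp u 2 (volume.restrict Ω)
def IsWeakD {n : ℕ} (Ω : Set (EuclideanSpace ℝ (Fin n)))
    (u v : EuclideanSpace ℝ (Fin n) → ℝ) (d : EuclideanSpace ℝ (Fin n)) : Prop :=
  ∀ φ : EuclideanSpace ℝ (Fin n) → ℝ, ContDiff ℝ (⊤ : ℕ∞) φ → HasCompactSupport φ → tsupport φ ⊆ Ω →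
    ∫ x in Ω, u x * fderiv ℝ φ x d = - ∫ x in Ω, v x * φ x
def tri (p : Fin 3 → E2) : Set E2 := interior (convexHull ℝ (range p))
def evec (p : Fin 3 → E2) (i : Fin 3) : E2 := p (i + 2) - p (i + 1)
def elen (p : Fin 3 → E2) (i : Fin 3) : ℝ := ‖evec p i‖
def tangv (p : Fin 3 → E2) (i : Fin 3) : E2 := (elen p i)⁻¹ • evec p i
def norv (p : Fin 3 → E2) (i : Fin 3) : E2 :=
  EuclideanSpace.single 0 (tangv p i 1) + EuclideanSpace.single 1 (-(tangv p i 0))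
def epar (p : Fin 3 → E2) (i : Fin 3) (t : ℝ) : E2 := p (i + 1) + t • evec p i
def ccw (p : Fin 3 → E2) : Prop :=
  0 < (p 1 - p 0) 0 * (p 2 - p 0) 1 - (p 1 - p 0) 1 * (p 2 - p 0) 0
def tau (i j : Fin 3) : ℝ := if i = j + 1 then 0 else 1

/-- weak derivative on an open interval of `ℝ` -/
def IsWeakD1 (S : Set ℝ) (u v : ℝ → ℝ) : Prop :=
  ∀ φ : ℝ → ℝ, ContDiff ℝ (⊤ : ℕ∞) φ → HasCompactSupport φ → tsupport φ ⊆ S →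
    ∫ t in S, u t * deriv φ t = - ∫ t in S, v t * φ t

def MemHedge : ℕ → (ℝ → ℝ) → Prop
  | 0, u => MemLp u 2 (volume.restrict (Ioo (0:ℝ) 1))
  | (k+1), u => MemLp u 2 (volume.restrict (Ioo (0:ℝ) 1)) ∧
      ∃ v, IsWeakD1 (Ioo (0:ℝ) 1) u v ∧ MemHedge k v

/-- membership of edgewise data in `H²(∂T) × H¹(∂T)` (with pointwise C¹/C⁰ representatives) -/
def MemBdryH2H1 (f g : Fin 3 → ℝ → ℝ) : Prop :=
  ∀ i, MemHedge 2 (f i) ∧ ContDiffOn ℝ 1 (f i) (Icc 0 1) ∧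
    MemHedge 1 (g i) ∧ ContinuousOn (g i) (Icc 0 1)

/-- compatibility conditions (2.2)-(2.4) -/
def Compat (p : Fin 3 → E2) (f g : Fin 3 → ℝ → ℝ) : Prop :=
  (∀ i j k : Fin 3, j ≠ i → k ≠ i → f j (tau i j) = f k (tau i k)) ∧
  ∃ w : Fin 3 → E2, ∀ i j : Fin 3, j ≠ i →
    derivWithin (f j) (Icc 0 1) (tau i j) = elen p j * ⟪w i, tangv p j⟫ ∧
    g j (tau i j) = ⟪w i, norv p j⟫

/-- `H²` membership with explicit weak gradient and Hessian data -/
def MemH2W {n : ℕ} (Ω : Set (EuclideanSpace ℝ (Fin n))) (ξ : EuclideanSpace ℝ (Fin n) → ℝ)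
    (G : Fin n → EuclideanSpace ℝ (Fin n) → ℝ)
    (Hs : Fin n → Fin n → EuclideanSpace ℝ (Fin n) → ℝ) : Prop :=
  L2on Ω ξ ∧ (∀ d, L2on Ω (G d) ∧ IsWeakD Ω ξ (G d) (EuclideanSpace.single d 1)) ∧
  ∀ d d', L2on Ω (Hs d d') ∧ IsWeakD Ω (G d) (Hs d d') (EuclideanSpace.single d' 1)

/-- Gagliardo-type `H^{1/2}` seminorm finiteness for functions on a domain in `ℝⁿ` -/
def GagH12 {n : ℕ} (Ω : Set (EuclideanSpace ℝ (Fin n))) (u : EuclideanSpace ℝ (Fin n) → ℝ) : Prop :=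
  Integrable (fun q : EuclideanSpace ℝ (Fin n) × EuclideanSpace ℝ (Fin n) =>
    (u q.1 - u q.2) ^ 2 / ‖q.1 - q.2‖ ^ (n + 1)) ((volume.restrict Ω).prod (volume.restrict Ω))

/-- membership in `H^{5/2}` of a domain: weak `H²` data whose second derivatives have finite
`H^{1/2}` Gagliardo seminorm. -/
def MemH52 {n : ℕ} (Ω : Set (EuclideanSpace ℝ (Fin n))) (ζ : EuclideanSpace ℝ (Fin n) → ℝ) : Prop :=
  ∃ G Hs, MemH2W Ω ζ G Hs ∧ ∀ d d', GagH12 Ω (Hs d d')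

/-- pointwise trace relation `Tr ζ = (f,g)` on `∂T` for a `C¹` function -/
def TraceEq (p : Fin 3 → E2) (ζ : E2 → ℝ) (f g : Fin 3 → ℝ → ℝ) : Prop :=
  ∀ i : Fin 3, ∀ t ∈ Icc (0:ℝ) 1,
    ζ (epar p i t) = f i t ∧ fderiv ℝ ζ (epar p i t) (norv p i) = g i t

theorem hlp_planch (f : ℝ → ℂ) (h1 : Integrable f) (h2 : MemLp f 2 volume) :
    ∫⁻ ξ, ‖FourierTransform.fourier f ξ‖ₑ ^ 2 = ∫⁻ x, ‖f x‖ₑ ^ 2 := by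
  set F : Lp ℂ 2 (volume : Measure ℝ) := h2.toLp f with hF
  have hcont : Continuous (FourierTransform.fourier f) :=
    VectorFourier.fourierIntegral_continuous Real.continuous_fourierChar
      (by exact continuous_inner) h1
  have key : (FourierTransform.fourier F : Lp ℂ 2 (volume : Measure ℝ)) =ᵐ[volume]
      FourierTransform.fourier f := by
    apply ae_eq_of_integral_contDiff_smul_eq
    · exact (Lp.memLp _).locallyIntegrable (by norm_num)
    · exact hcont.locallyIntegrable
    · intro g hg hgc
      set G : SchwartzMap ℝ ℂ :=
        HasCompactSupport.toSchwartzMap (f := fun x => (g x : ℂ))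
          (hgc.comp_left (g := fun x : ℝ => (x : ℂ)) (by simp))
          (Complex.ofRealCLM.contDiff.comp hg) with hG
      have e1 := MeasureTheory.Lp.fourier_toTemperedDistribution_eq F
      have e2 := congrArg (fun T => T G) e1
      simp only [TemperedDistribution.fourier_apply, Lp.toTemperedDistribution_apply] at e2
      have e3 := VectorFourier.integral_fourierIntegral_smul_eq_flip (L := innerₗ ℝ)
        (μ := volume) (ν := volume) (f := fun x => (g x : ℂ)) (g := f)
        Real.continuous_fourierChar continuous_inner G.integrable h1
      have e4 : ∫ x, g x • (FourierTransform.fourier F : Lp ℂ 2 (volume : Measure ℝ)) x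
          = ∫ x, G x • (FourierTransform.fourier F : Lp ℂ 2 (volume : Measure ℝ)) x := by
        congr 1
      have e5 : ∫ x, g x • FourierTransform.fourier f x
          = ∫ x, G x • FourierTransform.fourier f x := by
        congr 1
      rw [e4, e5, ← e2]
      have e6 : ∫ x, (FourierTransform.fourier G : SchwartzMap ℝ ℂ) x • F x
          = ∫ x, (FourierTransform.fourier G : SchwartzMap ℝ ℂ) x • f x := by
        apply integral_congr_ae
        filter_upwards [h2.coeFn_toLp] with x hx
        rw [hF, hx]
      rw [e6]
      rw [flip_innerₗ] at e3
      exact e3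
  have hn : ‖(FourierTransform.fourier F : Lp ℂ 2 (volume : Measure ℝ))‖ₑ = ‖F‖ₑ := by
    rw [← ofReal_norm, ← ofReal_norm, Lp.norm_fourier_eq]
  rw [Lp.enorm_def, Lp.enorm_def] at hn
  have hn2 : eLpNorm (FourierTransform.fourier f) 2 volume = eLpNorm f 2 volume := by
    rw [← eLpNorm_congr_ae key, hn, eLpNorm_congr_ae h2.coeFn_toLp]
  have aux : ∀ u : ℝ → ℂ, ∫⁻ x, ‖u x‖ₑ ^ 2 = eLpNorm u 2 volume ^ 2 := by
    intro u
    have := eLpNorm_nnreal_pow_eq_lintegral (μ := (volume : Measure ℝ)) (f := u) (p := 2) (by norm_num)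
    simpa using this.symm
  rw [aux, aux, hn2]

def hA (ψ h : ℝ → ℝ) (x y : ℝ) : ℝ := ∫ s in Icc (0:ℝ) 1, h (x - y * s) * ψ s

theorem hA_bdd {ψ : ℝ → ℝ} (hψ : Continuous ψ) : ∃ M : ℝ, 0 ≤ M ∧ ∀ s ∈ Icc (0:ℝ) 1, |ψ s| ≤ M := by
  obtain ⟨M, hM⟩ := (isCompact_Icc (a := (0:ℝ)) (b := 1)).exists_bound_of_continuousOn hψ.continuousOn
  exact ⟨M, (norm_nonneg _).trans (hM 0 (by simp)), fun s hs => hM s hs⟩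

theorem hA_int_s {ψ h : ℝ → ℝ} (hψ : Continuous ψ) (h1 : Integrable h) (x y : ℝ) :
    IntegrableOn (fun s => h (x - y * s) * ψ s) (Icc (0:ℝ) 1) := by
  by_cases hy : y = 0
  · subst hy
    simp only [zero_mul, sub_zero]
    exact (continuous_const.mul hψ).continuousOn.integrableOn_Icc
  · have : Integrable (fun s => h (x - y * s)) := (h1.comp_sub_left x).comp_mul_left' hy
    exact this.integrableOn.mul_continuousOn hψ.continuousOn isCompact_Icc

theorem hA_sm {ψ h : ℝ → ℝ} (hψ : Continuous ψ) (hm : Measurable h) :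
    StronglyMeasurable (fun q : ℝ × ℝ => hA ψ h q.1 q.2) := by
  have : StronglyMeasurable (fun r : (ℝ × ℝ) × ℝ => h (r.1.1 - r.1.2 * r.2) * ψ r.2) := by
    apply Measurable.stronglyMeasurable
    have := hψ.measurable
    fun_prop
  exact this.integral_prod_right (ν := volume.restrict (Icc (0:ℝ) 1))

theorem hA_int_prod {ψ h : ℝ → ℝ} (hψ : Continuous ψ) (hm : Measurable h) (h1 : Integrable h) (y : ℝ) :
    Integrable (fun q : ℝ × ℝ => h (q.1 - y * q.2) * ψ q.2)
      (volume.prod (volume.restrict (Icc (0:ℝ) 1))) := by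
  have hmm : Measurable (fun q : ℝ × ℝ => h (q.1 - y * q.2) * ψ q.2) := by
    have := hψ.measurable
    fun_prop
  rw [integrable_prod_iff' hmm.aestronglyMeasurable]
  constructor
  · filter_upwards with s
    exact (h1.comp_sub_right (y * s)).mul_const _
  · have : (fun s => ∫ x, ‖h (x - y * s) * ψ s‖) = fun s => (∫ x, ‖h x‖) * ‖ψ s‖ := by
      ext s
      simp only [norm_mul]
      rw [integral_mul_const, integral_sub_right_eq_self (fun x => ‖h x‖)]
    simp only []
    rw [this]
    exact (continuous_const.mul hψ.norm).continuousOn.integrableOn_Icc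

theorem hA_int_x {ψ h : ℝ → ℝ} (hψ : Continuous ψ) (hm : Measurable h) (h1 : Integrable h) (y : ℝ) :
    Integrable (fun x => hA ψ h x y) :=
  (hA_int_prod hψ hm h1 y).integral_prod_left

theorem hlp_jensen {f : ℝ → ℝ} (hf : AEMeasurable f (volume.restrict (Icc (0:ℝ) 1))) :
    ‖∫ s in Icc (0:ℝ) 1, f s‖ₑ ^ 2 ≤ ∫⁻ s in Icc (0:ℝ) 1, ‖f s‖ₑ ^ 2 := by
  have : IsProbabilityMeasure (volume.restrict (Icc (0:ℝ) 1)) := ⟨by simp⟩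
  have e1 : ‖∫ s in Icc (0:ℝ) 1, f s‖ₑ ≤ eLpNorm f 1 (volume.restrict (Icc (0:ℝ) 1)) := by
    rw [eLpNorm_one_eq_lintegral_enorm]
    exact enorm_integral_le_lintegral_enorm _
  have e2 := eLpNorm_le_eLpNorm_of_exponent_le (μ := volume.restrict (Icc (0:ℝ) 1)) (f := f)
    (p := 1) (q := 2) (by norm_num) hf.aestronglyMeasurable
  have e3 := eLpNorm_nnreal_pow_eq_lintegral (μ := volume.restrict (Icc (0:ℝ) 1)) (f := f) (p := 2)
    (by norm_num)
  calc _ ≤ (eLpNorm f 2 (volume.restrict (Icc (0:ℝ) 1))) ^ 2 := by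
        gcongr; exact e1.trans e2
    _ = _ := by simpa using e3

theorem hA_L2_x {ψ h : ℝ → ℝ} (hψ : Continuous ψ) (hm : Measurable h)  :
    ∃ M : ℝ, 0 ≤ M ∧ ∀ y, ∫⁻ x, ‖hA ψ h x y‖ₑ ^ 2 ≤ ENNReal.ofReal M * ∫⁻ x, ‖h x‖ₑ ^ 2 := by
  obtain ⟨M, hM0, hM⟩ := hA_bdd hψ
  refine ⟨M ^ 2, by positivity, fun y => ?_⟩
  calc ∫⁻ x, ‖hA ψ h x y‖ₑ ^ 2
      ≤ ∫⁻ x, ∫⁻ s in Icc (0:ℝ) 1, ‖h (x - y * s) * ψ s‖ₑ ^ 2 := by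
        apply lintegral_mono
        intro x
        apply hlp_jensen
        have := hψ.measurable
        apply Measurable.aemeasurable
        fun_prop
    _ = ∫⁻ s in Icc (0:ℝ) 1, ∫⁻ x, ‖h (x - y * s) * ψ s‖ₑ ^ 2 := by
        apply lintegral_lintegral_swap
        have := hψ.measurable
        apply Measurable.aemeasurable
        fun_prop
    _ ≤ ∫⁻ s in Icc (0:ℝ) 1, ENNReal.ofReal (M ^ 2) * ∫⁻ x, ‖h x‖ₑ ^ 2 := by
        apply setLIntegral_mono (by fun_prop)
        intro s hs
        calc _ ≤ ∫⁻ x, ENNReal.ofReal (M ^ 2) * ‖h (x - y * s)‖ₑ ^ 2 := by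
              apply lintegral_mono
              intro x
              simp only [enorm_mul, mul_pow]
              rw [mul_comm]
              gcongr
              rw [ENNReal.ofReal_pow hM0]
              gcongr
              rw [← ofReal_norm]
              exact ENNReal.ofReal_le_ofReal (hM s hs)
          _ = _ := by
              rw [lintegral_const_mul' _ _ (by finiteness)]
              rw [lintegral_sub_right_eq_self (fun x => ‖h x‖ₑ ^ 2)]
    _ = _ := by simp

theorem hA_memL2_x {ψ h : ℝ → ℝ} (hψ : Continuous ψ) (hm : Measurable h) (h2 : MemLp h 2 volume) (y : ℝ) :
    MemLp (fun x => hA ψ h x y) 2 volume := by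
  obtain ⟨M, hM0, hM⟩ := hA_L2_x hψ hm
  refine ⟨((hA_sm hψ hm).comp_measurable (by fun_prop : Measurable fun x : ℝ => (x, y))).aestronglyMeasurable, ?_⟩
  have e3 := fun u : ℝ → ℝ => eLpNorm_nnreal_pow_eq_lintegral (μ := (volume : Measure ℝ)) (f := u) (p := 2)
    (by norm_num)
  simp only [ENNReal.coe_ofNat, NNReal.coe_ofNat, ENNReal.rpow_ofNat] at e3
  have : eLpNorm (fun x => hA ψ h x y) 2 volume ^ 2 < ⊤ := by
    rw [e3]
    refine (hM y).trans_lt ?_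
    rw [← e3]
    have := h2.2
    finiteness
  exact ENNReal.pow_lt_top_iff.1 this |>.resolve_right (by norm_num)

def hPhi (ψ : ℝ → ℝ) (η : ℝ) : ℂ :=
  FourierTransform.fourier (fun s => (((Icc (0:ℝ) 1).indicator ψ s : ℝ) : ℂ)) η

theorem hA_fourier {ψ h : ℝ → ℝ} (hψ : Continuous ψ) (hm : Measurable h) (h1 : Integrable h) (y ξ : ℝ) :
    FourierTransform.fourier (fun x => (hA ψ h x y : ℂ)) ξ =
      FourierTransform.fourier (fun x => (h x : ℂ)) ξ * hPhi ψ (y * ξ) := by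
  rw [hPhi, Real.fourier_real_eq, Real.fourier_real_eq, Real.fourier_real_eq]
  simp only [Circle.smul_def, smul_eq_mul]
  have e0 : ∀ x : ℝ, (Real.fourierChar (-(x * ξ)) : ℂ) * ((hA ψ h x y : ℝ) : ℂ) =
      ∫ s in Icc (0:ℝ) 1, (Real.fourierChar (-(x * ξ)) : ℂ) * ((h (x - y * s) * ψ s : ℝ) : ℂ) := by
    intro x
    rw [hA, ← integral_complex_ofReal, integral_const_mul]
  simp only [e0]
  rw [integral_integral_swap]
  · have e1 : ∀ s : ℝ, ∫ x, (Real.fourierChar (-(x * ξ)) : ℂ) * ((h (x - y * s) * ψ s : ℝ) : ℂ) =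
        (∫ x, (Real.fourierChar (-(x * ξ)) : ℂ) * (h x : ℂ)) *
          ((Real.fourierChar (-(s * (y * ξ))) : ℂ) * (ψ s : ℂ)) := by
      intro s
      rw [← integral_mul_const,
        ← integral_sub_right_eq_self (fun x => (Real.fourierChar (-(x * ξ)) : ℂ) * (h x : ℂ) *
          ((Real.fourierChar (-(s * (y * ξ))) : ℂ) * (ψ s : ℂ))) (y * s)]
      congr 1
      ext x
      have : (Real.fourierChar (-(x * ξ)) : ℂ) = (Real.fourierChar (-((x - y * s) * ξ)) : ℂ) *
          (Real.fourierChar (-(s * (y * ξ))) : ℂ) := by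
        rw [← Circle.coe_mul, ← AddChar.map_add_eq_mul]
        congr 2
        ring
      rw [this]
      push_cast
      ring
    simp only [e1]
    rw [integral_const_mul, ← integral_indicator measurableSet_Icc]
    congr 2
    ext s
    by_cases hs : s ∈ Icc (0:ℝ) 1 <;> simp [hs]
  · have := (hA_int_prod hψ hm h1 y).ofReal (𝕜 := ℂ)
    refine this.bdd_mul (c := 1) (f := fun q : ℝ × ℝ => (Real.fourierChar (-(q.1 * ξ)) : ℂ)) ?_ ?_
    · apply Continuous.aestronglyMeasurable
      have := Real.continuous_fourierChar
      fun_prop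
    · filter_upwards with q
      exact (Circle.norm_coe _).le

theorem hA_diff {ψ h : ℝ → ℝ} (hψ : Continuous ψ) (hm : Measurable h) (h1 : Integrable h)
    (h2 : MemLp h 2 volume) (t y y' : ℝ) :
    ∫⁻ x, ‖hA ψ h (x + t) y' - hA ψ h x y‖ₑ ^ 2 =
    ∫⁻ ξ, ‖FourierTransform.fourier (fun x => (h x : ℂ)) ξ‖ₑ ^ 2 *
      ‖(Real.fourierChar (t * ξ) : ℂ) * hPhi ψ (y' * ξ) - hPhi ψ (y * ξ)‖ₑ ^ 2 := by
  have i1 : Integrable (fun x => (hA ψ h (x + t) y' : ℂ)) :=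
    ((hA_int_x hψ hm h1 y').comp_add_right t).ofReal
  have i2 : Integrable (fun x => (hA ψ h x y : ℂ)) := (hA_int_x hψ hm h1 y).ofReal
  have m1 : MemLp (fun x => (hA ψ h (x + t) y' : ℂ)) 2 volume :=
    ((hA_memL2_x hψ hm h2 y').comp_measurePreserving (measurePreserving_add_right volume t)).ofReal
  have m2 : MemLp (fun x => (hA ψ h x y : ℂ)) 2 volume := (hA_memL2_x hψ hm h2 y).ofReal
  have := hlp_planch (fun x => (hA ψ h (x + t) y' : ℂ) - (hA ψ h x y : ℂ)) (i1.sub i2) (m1.sub m2)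
  have e : ∀ x, ‖hA ψ h (x + t) y' - hA ψ h x y‖ₑ = ‖(hA ψ h (x + t) y' : ℂ) - (hA ψ h x y : ℂ)‖ₑ := by
    intro x
    rw [← Complex.ofReal_sub, ← ofReal_norm, ← ofReal_norm, Complex.norm_real]
  simp only [e]
  rw [← this]
  congr 1
  ext ξ
  rw [← mul_pow, ← enorm_mul]
  congr 2
  have f1 : FourierTransform.fourier (fun x => (hA ψ h (x + t) y' : ℂ)) ξ =
      (Real.fourierChar (t * ξ) : ℂ) * FourierTransform.fourier (fun x => (hA ψ h x y' : ℂ)) ξ := by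
    have := congrFun (VectorFourier.fourierIntegral_comp_add_right Real.fourierChar volume (innerₗ ℝ)
      (fun x => (hA ψ h x y' : ℂ)) t) ξ
    simp only [Circle.smul_def, smul_eq_mul] at this
    rw [show ((innerₗ ℝ) t) ξ = t * ξ by simp [mul_comm]] at this
    exact this
  have f2 : FourierTransform.fourier (fun x => (hA ψ h (x + t) y' : ℂ) - (hA ψ h x y : ℂ)) ξ =
      FourierTransform.fourier (fun x => (hA ψ h (x + t) y' : ℂ)) ξ -
      FourierTransform.fourier (fun x => (hA ψ h x y : ℂ)) ξ := by
    rw [Real.fourier_real_eq, Real.fourier_real_eq, Real.fourier_real_eq]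
    rw [← integral_sub]
    · simp only [smul_sub]
    · exact (Real.fourierIntegral_convergent_iff (μ := volume) ξ).2 i1 |>.congr (by
        filter_upwards with x; simp [mul_comm])
    · exact (Real.fourierIntegral_convergent_iff (μ := volume) ξ).2 i2 |>.congr (by
        filter_upwards with x; simp [mul_comm])
  rw [f2, f1, hA_fourier hψ hm h1, hA_fourier hψ hm h1]
  ring

theorem hlp_char_bound (a : ℝ) : ‖(Real.fourierChar a : ℂ) - 1‖ ^ 2 ≤ 4 * π ^ 2 * min 1 (a ^ 2) := by
  have h1 : ‖(Real.fourierChar a : ℂ) - 1‖ ≤ 2 := by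
    calc _ ≤ ‖(Real.fourierChar a : ℂ)‖ + ‖(1:ℂ)‖ := norm_sub_le _ _
      _ = 2 := by rw [show ‖(Real.fourierChar a : ℂ)‖ = 1 from Circle.norm_coe _]; norm_num
  have h2 : ‖(Real.fourierChar a : ℂ) - 1‖ ≤ 2 * π * |a| := by
    rw [Real.fourierChar_apply]
    have := Real.norm_exp_I_mul_ofReal_sub_one_le (x := 2 * π * a)
    rw [mul_comm Complex.I] at this
    refine this.trans ?_
    simp [abs_of_pos Real.pi_pos]
  have hp := Real.pi_gt_three
  rcases min_cases 1 (a ^ 2) with ⟨h, _⟩ | ⟨h, _⟩ <;> rw [h]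
  · have : ‖(Real.fourierChar a : ℂ) - 1‖ ^ 2 ≤ 2 ^ 2 := by gcongr
    nlinarith
  · have : ‖(Real.fourierChar a : ℂ) - 1‖ ^ 2 ≤ (2 * π * |a|) ^ 2 := by gcongr
    rw [mul_pow, sq_abs] at this
    linarith

theorem hPhi_N {ψ : ℝ → ℝ} (hψ : Continuous ψ) : ∃ C : ℝ, 0 ≤ C ∧ ∀ τ δ : ℝ,
    ∫⁻ η, ‖(Real.fourierChar τ : ℂ) * hPhi ψ (η + δ) - hPhi ψ η‖ₑ ^ 2 ≤
      ENNReal.ofReal (C * min 1 (τ ^ 2 + δ ^ 2)) := by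
  obtain ⟨M, hM0, hM⟩ := hA_bdd hψ
  refine ⟨M ^ 2 * (8 * π ^ 2), by positivity, fun τ δ => ?_⟩
  set Ψ : ℝ → ℂ := fun s => (((Icc (0:ℝ) 1).indicator ψ s : ℝ) : ℂ) with hΨ
  have hmeas : Measurable Ψ := by
    apply Complex.measurable_ofReal.comp
    exact hψ.measurable.indicator measurableSet_Icc
  have iΨ : Integrable Ψ := by
    have : Integrable ((Icc (0:ℝ) 1).indicator ψ) := by
      rw [integrable_indicator_iff measurableSet_Icc]
      exact hψ.continuousOn.integrableOn_Icc
    exact this.ofReal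
  set G : ℝ → ℂ := fun s => (Real.fourierChar (τ - s * δ) : ℂ) * Ψ s - Ψ s with hG
  have cch : Continuous fun s : ℝ => (Real.fourierChar (τ - s * δ) : ℂ) := by
    have := Real.continuous_fourierChar
    fun_prop
  have i1 : Integrable (fun s => (Real.fourierChar (τ - s * δ) : ℂ) * Ψ s) := by
    refine iΨ.bdd_mul (c := 1) cch.aestronglyMeasurable ?_
    filter_upwards with q
    exact (Circle.norm_coe _).le
  have iG : Integrable G := i1.sub iΨ
  have bG : ∀ s, ‖G s‖ₑ ^ 2 ≤ (Icc (0:ℝ) 1).indicator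
      (fun _ => ENNReal.ofReal (M ^ 2 * (8 * π ^ 2) * min 1 (τ ^ 2 + δ ^ 2))) s := by
    intro s
    by_cases hs : s ∈ Icc (0:ℝ) 1
    · rw [indicator_of_mem hs, ← ofReal_norm, ← ENNReal.ofReal_pow (norm_nonneg _)]
      apply ENNReal.ofReal_le_ofReal
      have : G s = ((Real.fourierChar (τ - s * δ) : ℂ) - 1) * (ψ s : ℂ) := by
        simp only [hG, hΨ, indicator_of_mem hs]; ring
      rw [this, norm_mul, mul_pow, Complex.norm_real, mul_comm, mul_assoc]
      have b1 := hlp_char_bound (τ - s * δ)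
      have b2 : ‖ψ s‖ ^ 2 ≤ M ^ 2 := by gcongr; exact hM s hs
      have b3 : min 1 ((τ - s * δ) ^ 2) ≤ 2 * min 1 (τ ^ 2 + δ ^ 2) := by
        have : (τ - s * δ) ^ 2 ≤ 2 * (τ ^ 2 + δ ^ 2) := by
          have : s ^ 2 * δ ^ 2 ≤ δ ^ 2 := by
            have : s ^ 2 ≤ 1 := by nlinarith [hs.1, hs.2]
            nlinarith [sq_nonneg δ]
          nlinarith [sq_nonneg (τ + s * δ)]
        rcases min_cases 1 (τ ^ 2 + δ ^ 2) with ⟨h, _⟩ | ⟨h, _⟩ <;> rw [h]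
        · exact (min_le_left _ _).trans (by norm_num)
        · exact (min_le_right _ _).trans this
      have hp := Real.pi_pos
      calc ‖ψ s‖ ^ 2 * ‖(Real.fourierChar (τ - s * δ) : ℂ) - 1‖ ^ 2
          ≤ M ^ 2 * (4 * π ^ 2 * (2 * min 1 (τ ^ 2 + δ ^ 2))) := by
            gcongr
            exact b1.trans (by gcongr)
        _ = _ := by ring
    · simp [hG, hΨ, indicator_of_notMem hs]
  have tot : ∫⁻ s, ‖G s‖ₑ ^ 2 ≤ ENNReal.ofReal (M ^ 2 * (8 * π ^ 2) * min 1 (τ ^ 2 + δ ^ 2)) := by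
    refine (lintegral_mono bG).trans ?_
    rw [lintegral_indicator measurableSet_Icc]
    simp
  have mG : MemLp G 2 volume := by
    refine ⟨iG.aestronglyMeasurable, ?_⟩
    have e3 := eLpNorm_nnreal_pow_eq_lintegral (μ := (volume : Measure ℝ)) (f := G) (p := 2)
      (by norm_num)
    simp only [ENNReal.coe_ofNat, NNReal.coe_ofNat, ENNReal.rpow_ofNat] at e3
    have : eLpNorm G 2 volume ^ 2 < ⊤ := by
      rw [e3]
      exact tot.trans_lt ENNReal.ofReal_lt_top
    exact ENNReal.pow_lt_top_iff.1 this |>.resolve_right (by norm_num)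
  rw [← hlp_planch G iG mG] at tot
  refine le_trans (le_of_eq ?_) tot
  congr 1
  ext η
  congr 2
  rw [hPhi, hPhi, Real.fourier_real_eq, Real.fourier_real_eq, Real.fourier_real_eq]
  simp only [Circle.smul_def, smul_eq_mul, hG, mul_sub]
  rw [integral_sub, ← integral_const_mul]
  · congr 2
    ext s
    rw [← mul_assoc, ← mul_assoc, ← Circle.coe_mul, ← Circle.coe_mul, ← AddChar.map_add_eq_mul,
      ← AddChar.map_add_eq_mul]
    congr 3
    ring
  · refine i1.bdd_mul (c := 1) (Continuous.aestronglyMeasurable ?_) ?_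
    · have := Real.continuous_fourierChar
      fun_prop
    · filter_upwards with q
      exact (Circle.norm_coe _).le
  · refine iΨ.bdd_mul (c := 1) (Continuous.aestronglyMeasurable ?_) ?_
    · have := Real.continuous_fourierChar
      fun_prop
    · filter_upwards with q
      exact (Circle.norm_coe _).le

theorem hPhi_cont {ψ : ℝ → ℝ} (hψ : Continuous ψ) : Continuous (hPhi ψ) := by
  have iΨ : Integrable (fun s => (((Icc (0:ℝ) 1).indicator ψ s : ℝ) : ℂ)) := by
    have : Integrable ((Icc (0:ℝ) 1).indicator ψ) := by
      rw [integrable_indicator_iff measurableSet_Icc]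
      exact hψ.continuousOn.integrableOn_Icc
    exact this.ofReal
  exact VectorFourier.fourierIntegral_continuous Real.continuous_fourierChar
      (by exact continuous_inner) iΨ

theorem hlp_scale (f : ℝ → ENNReal) (hf : Measurable f) (ξ : ℝ) (h : ξ ≠ 0) :
    ∫⁻ y, f (y * ξ) = ENNReal.ofReal |ξ⁻¹| * ∫⁻ η, f η := by
  rw [← smul_eq_mul, ← lintegral_smul_measure, ← Real.map_volume_mul_right h, lintegral_map hf]
  fun_prop

theorem hA_omega {ψ h : ℝ → ℝ} (hψ : Continuous ψ) (hm : Measurable h) (h1 : Integrable h)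
    (h2 : MemLp h 2 volume) : ∃ C : ℝ, 0 ≤ C ∧ ∀ t Δ : ℝ,
    ∫⁻ y, ∫⁻ x, ‖hA ψ h (x + t) (y + Δ) - hA ψ h x y‖ₑ ^ 2 ≤
    ∫⁻ ξ, ‖FourierTransform.fourier (fun x => (h x : ℂ)) ξ‖ₑ ^ 2 *
      ENNReal.ofReal (C * |ξ⁻¹| * min 1 ((t ^ 2 + Δ ^ 2) * ξ ^ 2)) := by
  obtain ⟨C, hC0, hC⟩ := hPhi_N hψ
  refine ⟨C, hC0, fun t Δ => ?_⟩
  have hPc := hPhi_cont hψ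
  have hhc : Continuous (FourierTransform.fourier (fun x => (h x : ℂ))) :=
    VectorFourier.fourierIntegral_continuous Real.continuous_fourierChar
      (by exact continuous_inner) h1.ofReal
  have hcc := Real.continuous_fourierChar
  simp only [hA_diff hψ hm h1 h2]
  rw [lintegral_lintegral_swap]
  · apply lintegral_mono_ae
    have : ∀ᵐ ξ : ℝ, ξ ≠ 0 := by simp [ae_iff]
    filter_upwards [this] with ξ hξ
    rw [lintegral_const_mul']
    swap
    · finiteness
    gcongr
    have e : ∀ y, (Real.fourierChar (t * ξ) : ℂ) * hPhi ψ ((y + Δ) * ξ) - hPhi ψ (y * ξ) =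
      (Real.fourierChar (t * ξ) : ℂ) * hPhi ψ (y * ξ + Δ * ξ) - hPhi ψ (y * ξ) := by
      intro y; rw [add_mul]
    simp only [e]
    rw [hlp_scale (fun η => ‖(Real.fourierChar (t * ξ) : ℂ) * hPhi ψ (η + Δ * ξ) - hPhi ψ η‖ₑ ^ 2) _ ξ hξ]
    · calc _ ≤ ENNReal.ofReal |ξ⁻¹| * ENNReal.ofReal (C * min 1 ((t * ξ) ^ 2 + (Δ * ξ) ^ 2)) := by
            gcongr
            exact hC _ _
        _ = _ := by
            rw [← ENNReal.ofReal_mul (abs_nonneg _)]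
            congr 1
            rw [show (t ^ 2 + Δ ^ 2) * ξ ^ 2 = (t * ξ) ^ 2 + (Δ * ξ) ^ 2 by ring]
            ring
    · apply Continuous.measurable
      fun_prop
  · have : Continuous fun ξ : ℝ => (Real.fourierChar (t * ξ) : ℂ) := by fun_prop
    unfold Function.uncurry
    simp only []
    have c1 : Continuous fun q : ℝ × ℝ => ((Real.fourierChar (t * q.2) : Circle) : ℂ) := this.comp continuous_snd
    have m1 : Measurable fun q : ℝ × ℝ => ‖FourierTransform.fourier (fun x => (h x : ℂ)) q.2‖ₑ ^ 2 :=
      (hhc.comp continuous_snd).measurable.enorm.pow_const 2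
    have c2 : Continuous fun q : ℝ × ℝ => ((Real.fourierChar (t * q.2) : Circle) : ℂ) *
      hPhi ψ ((q.1 + Δ) * q.2) - hPhi ψ (q.1 * q.2) := by fun_prop
    exact (m1.mul (c2.measurable.enorm.pow_const 2)).aemeasurable

def hkern (V : E2) : ENNReal := ENNReal.ofReal (min 1 (‖V‖ ^ 2) / ‖V‖ ^ 3)

theorem hkern_meas : Measurable hkern := by
  unfold hkern
  fun_prop

theorem hkern_fin : ∫⁻ V, hkern V < ⊤ := by
  have : Integrable (fun V : E2 => (fun r : ℝ => min 1 (r ^ 2) / r ^ 3) ‖V‖) := by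
    refine (integrable_fun_norm_addHaar (volume : Measure E2) (f := fun r : ℝ => min 1 (r ^ 2) / r ^ 3)).2 ?_
    simp only [finrank_euclideanSpace, Fintype.card_fin, Nat.add_one_sub_one, pow_one, smul_eq_mul]
    rw [← Ioc_union_Ioi_eq_Ioi (zero_le_one (α := ℝ))]
    apply IntegrableOn.union
    · apply (integrableOn_const (C := (1:ℝ)) (s := Ioc (0:ℝ) 1) (by simp)).congr_fun _ measurableSet_Ioc
      intro r hr
      have : min 1 (r ^ 2) = r ^ 2 := min_eq_right (by nlinarith [hr.1, hr.2])
      simp only [this]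
      field_simp [hr.1.ne']
    · have := integrableOn_Ioi_rpow_of_lt (a := -2) (by norm_num) (c := 1) (by norm_num)
      apply this.congr_fun _ measurableSet_Ioi
      intro r hr
      have hr' : (1:ℝ) < r := hr
      have : min 1 (r ^ 2) = 1 := min_eq_left (by nlinarith)
      simp only [this]
      rw [Real.rpow_neg (by linarith)]
      norm_cast
      field_simp
  have h2 := this.lintegral_lt_top
  exact h2

theorem hkern_scale (ξ : ℝ) (h : ξ ≠ 0) :
    ∫⁻ V : E2, ENNReal.ofReal (min 1 (‖V‖ ^ 2 * ξ ^ 2) / ‖V‖ ^ 3) = ENNReal.ofReal |ξ| * ∫⁻ V, hkern V := by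
  have e : ∀ V : E2, ENNReal.ofReal (min 1 (‖V‖ ^ 2 * ξ ^ 2) / ‖V‖ ^ 3) =
      ENNReal.ofReal (|ξ| ^ 3) * hkern (ξ • V) := by
    intro V
    rw [hkern, ← ENNReal.ofReal_mul (by positivity)]
    congr 1
    rw [norm_smul, mul_pow, mul_pow, Real.norm_eq_abs, sq_abs, mul_comm (ξ ^ 2)]
    field_simp
  simp only [e]
  rw [lintegral_const_mul _ (by have := hkern_meas; fun_prop)]
  have := Measure.map_addHaar_smul (volume : Measure E2) h
  have e2 : ∫⁻ V : E2, hkern (ξ • V) = ENNReal.ofReal (|ξ| ^ 2)⁻¹ * ∫⁻ V, hkern V := by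
    rw [← lintegral_map hkern_meas (by fun_prop), this, lintegral_smul_measure, smul_eq_mul]
    simp [abs_inv]
  rw [e2, ← mul_assoc, ← ENNReal.ofReal_mul (by positivity)]
  congr 2
  field_simp

theorem hlp_coord (α β : E2 →L[ℝ] ℝ) (hind : ∀ d, α d = 0 → β d = 0 → d = 0) (a b : ℝ) :
    ∃ c : ENNReal, c < ⊤ ∧ ∀ F : ℝ × ℝ → ENNReal, Measurable F →
      ∫⁻ P : E2, F (a + α P, b + β P) = c * ∫⁻ y, ∫⁻ x, F (x, y) := by
  have hinj : Function.Injective (α.prod β : E2 →L[ℝ] ℝ × ℝ).toLinearMap := by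
    rw [← LinearMap.ker_eq_bot, LinearMap.ker_eq_bot']
    intro d hd
    have h1 := congrArg Prod.fst hd
    have h2 := congrArg Prod.snd hd
    exact hind d h1 h2
  let e : E2 ≃ₗ[ℝ] ℝ × ℝ := LinearMap.linearEquivOfInjective _ hinj (by simp)
  have he : ∀ P, e.toContinuousLinearEquiv P = (α P, β P) := fun P => rfl
  let μ : Measure (ℝ × ℝ) := Measure.map e.toContinuousLinearEquiv (volume : Measure E2)
  have hμ : μ.IsAddHaarMeasure := ContinuousLinearEquiv.isAddHaarMeasure_map _ _
  have h3 := Measure.isAddLeftInvariant_eq_smul μ (volume : Measure (ℝ × ℝ))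
  refine ⟨(μ.addHaarScalarFactor (volume : Measure (ℝ × ℝ)) : ENNReal), ENNReal.coe_lt_top, fun F hF => ?_⟩
  have e1 : ∫⁻ P : E2, F (a + α P, b + β P) = ∫⁻ q, F ((a, b) + q) ∂μ := by
    rw [lintegral_map (by fun_prop) (by fun_prop)]
    rfl
  rw [e1, lintegral_add_left_eq_self F (a, b)]
  have h4 : ∫⁻ q, F q ∂μ = ∫⁻ q, F q ∂(μ.addHaarScalarFactor volume • (volume : Measure (ℝ × ℝ))) :=
    congrArg (fun ν => ∫⁻ q, F q ∂ν) h3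
  rw [h4, lintegral_smul_measure]
  have h5 : ∫⁻ q : ℝ × ℝ, F q = ∫⁻ y, ∫⁻ x, F (x, y) := lintegral_prod_symm F hF.aemeasurable
  rw [h5]
  rfl

theorem hE_sm {ψ h : ℝ → ℝ} (hψ : Continuous ψ) (hm : Measurable h)
    (α β : E2 →L[ℝ] ℝ) (a b : ℝ) : StronglyMeasurable (fun P : E2 => hA ψ h (a + α P) (b + β P)) := by
  have := hA_sm hψ hm
  exact this.comp_measurable (g := fun P : E2 => (a + α P, b + β P)) (by fun_prop)

theorem hlp_gag_of (u : E2 → ℝ) (hu : Measurable u)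
    (H : ∫⁻ V : E2, ENNReal.ofReal (1 / ‖V‖ ^ 3) * ∫⁻ Q : E2, ‖u (V + Q) - u Q‖ₑ ^ 2 < ⊤)
    (Ω : Set E2) : GagH12 Ω u := by
  unfold GagH12
  rw [Measure.prod_restrict]
  apply Integrable.mono_measure _ Measure.restrict_le_self
  have hmm : Measurable (fun q : E2 × E2 => (u q.1 - u q.2) ^ 2 / ‖q.1 - q.2‖ ^ (2 + 1)) := by fun_prop
  refine ⟨hmm.aestronglyMeasurable, ?_⟩
  unfold HasFiniteIntegral
  have e0 : ∀ q : E2 × E2, ‖(u q.1 - u q.2) ^ 2 / ‖q.1 - q.2‖ ^ (2 + 1)‖ₑ =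
      ENNReal.ofReal (1 / ‖q.1 - q.2‖ ^ 3) * ‖u q.1 - u q.2‖ₑ ^ 2 := by
    intro q
    rw [div_eq_mul_one_div, enorm_mul, mul_comm, enorm_pow]
    congr 1
    rw [Real.enorm_eq_ofReal (by positivity)]
  simp only [e0]
  have hm2 : Measurable (fun q : E2 × E2 => ENNReal.ofReal (1 / ‖q.1 - q.2‖ ^ 3) * ‖u q.1 - u q.2‖ₑ ^ 2) := by
    fun_prop
  rw [lintegral_prod_symm _ hm2.aemeasurable]
  calc _ = ∫⁻ Q : E2, ∫⁻ V : E2, ENNReal.ofReal (1 / ‖V‖ ^ 3) * ‖u (V + Q) - u Q‖ₑ ^ 2 := by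
        congr 1; ext Q
        rw [← lintegral_add_right_eq_self _ Q]
        simp
    _ = ∫⁻ V : E2, ∫⁻ Q : E2, ENNReal.ofReal (1 / ‖V‖ ^ 3) * ‖u (V + Q) - u Q‖ₑ ^ 2 := by
        apply lintegral_lintegral_swap
        apply Measurable.aemeasurable
        unfold Function.uncurry
        fun_prop
    _ = ∫⁻ V : E2, ENNReal.ofReal (1 / ‖V‖ ^ 3) * ∫⁻ Q : E2, ‖u (V + Q) - u Q‖ₑ ^ 2 := by
        congr 1; ext V
        rw [lintegral_const_mul' _ _ (by finiteness)]
    _ < ⊤ := H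

theorem hE_gag {ψ h : ℝ → ℝ} (hψ : Continuous ψ) (hm : Measurable h) (h1 : Integrable h)
    (h2 : MemLp h 2 volume) (α β : E2 →L[ℝ] ℝ) (hind : ∀ d, α d = 0 → β d = 0 → d = 0) (a b : ℝ)
    (Ω : Set E2) : GagH12 Ω (fun P : E2 => hA ψ h (a + α P) (b + β P)) := by
  apply hlp_gag_of _ (hE_sm hψ hm α β a b).measurable
  obtain ⟨C, hC0, hC⟩ := hA_omega hψ hm h1 h2
  obtain ⟨c, hc, hF⟩ := hlp_coord α β hind a b
  obtain ⟨L, hL, hLb⟩ : ∃ L : ℝ, 0 < L ∧ ∀ V, (α V) ^ 2 + (β V) ^ 2 ≤ ‖V‖ ^ 2 * L ^ 2 := by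
    refine ⟨‖α‖ + ‖β‖ + 1, by positivity, fun V => ?_⟩
    have b1 := α.le_opNorm V
    have b2 := β.le_opNorm V
    have s1 : (α V) ^ 2 ≤ (‖α‖ * ‖V‖) ^ 2 := sq_le_sq' (by have := neg_abs_le (α V); rw [Real.norm_eq_abs] at b1; linarith) (le_trans (le_abs_self _) b1)
    have s2 : (β V) ^ 2 ≤ (‖β‖ * ‖V‖) ^ 2 := sq_le_sq' (by have := neg_abs_le (β V); rw [Real.norm_eq_abs] at b2; linarith) (le_trans (le_abs_self _) b2)
    have n1 := norm_nonneg α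
    have n2 := norm_nonneg β
    have : 0 ≤ ‖V‖ ^ 2 := by positivity
    calc _ ≤ ‖V‖ ^ 2 * (‖α‖ ^ 2 + ‖β‖ ^ 2) := by nlinarith
      _ ≤ _ := by gcongr; nlinarith [mul_nonneg n1 n2]
  have hhc : Continuous (FourierTransform.fourier (fun x => (h x : ℂ))) :=
    VectorFourier.fourierIntegral_continuous Real.continuous_fourierChar
      (by exact continuous_inner) h1.ofReal
  set H := FourierTransform.fourier (fun x => (h x : ℂ)) with hH
  have smu : Measurable (fun q : ℝ × ℝ => hA ψ h q.1 q.2) := (hA_sm hψ hm).measurable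
  have inner : ∀ V : E2, ∫⁻ Q : E2, ‖hA ψ h (a + α (V + Q)) (b + β (V + Q)) - hA ψ h (a + α Q) (b + β Q)‖ₑ ^ 2
      ≤ c * ∫⁻ ξ, ‖H ξ‖ₑ ^ 2 * ENNReal.ofReal (C * |ξ⁻¹| * min 1 (‖V‖ ^ 2 * (L * ξ) ^ 2)) := by
    intro V
    have key := hF (fun q => ‖hA ψ h (q.1 + α V) (q.2 + β V) - hA ψ h q.1 q.2‖ₑ ^ 2) (by
      have m1 : Measurable (fun q : ℝ × ℝ => hA ψ h (q.1 + α V) (q.2 + β V)) :=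
        smu.comp (g := fun q : ℝ × ℝ => hA ψ h q.1 q.2) (f := fun q : ℝ × ℝ => (q.1 + α V, q.2 + β V)) (by fun_prop)
      exact (m1.sub smu).enorm.pow_const 2)
    calc _ = c * ∫⁻ y, ∫⁻ x, ‖hA ψ h (x + α V) (y + β V) - hA ψ h x y‖ₑ ^ 2 := by
          rw [← key]
          congr 1; ext Q
          rw [map_add, map_add]
          congr 4 <;> ring
      _ ≤ _ := by
          refine mul_le_mul_right ((hC _ _).trans ?_) c
          apply lintegral_mono
          intro ξ
          have b3 : (α V ^ 2 + β V ^ 2) * ξ ^ 2 ≤ ‖V‖ ^ 2 * (L * ξ) ^ 2 := by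
            rw [mul_pow, ← mul_assoc]
            exact mul_le_mul_of_nonneg_right (hLb V) (sq_nonneg _)
          simp only []
          gcongr
  calc _ ≤ ∫⁻ V : E2, ENNReal.ofReal (1 / ‖V‖ ^ 3) * (c * ∫⁻ ξ, ‖H ξ‖ₑ ^ 2 *
        ENNReal.ofReal (C * |ξ⁻¹| * min 1 (‖V‖ ^ 2 * (L * ξ) ^ 2))) := by
        gcongr with V
        exact inner V
    _ = ∫⁻ V : E2, ∫⁻ ξ, c * ENNReal.ofReal C * ‖H ξ‖ₑ ^ 2 * (ENNReal.ofReal |ξ⁻¹| *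
        ENNReal.ofReal (min 1 (‖V‖ ^ 2 * (L * ξ) ^ 2) / ‖V‖ ^ 3)) := by
        congr 1; ext V
        rw [← lintegral_const_mul' _ _ hc.ne, ← lintegral_const_mul' _ _ (by finiteness)]
        congr 1; ext ξ
        rw [ENNReal.ofReal_mul (by positivity), ENNReal.ofReal_mul hC0,
          div_eq_mul_one_div (min 1 _), ENNReal.ofReal_mul (p := min 1 _) (by positivity)]
        ring
    _ = ∫⁻ ξ, ∫⁻ V : E2, c * ENNReal.ofReal C * ‖H ξ‖ₑ ^ 2 * (ENNReal.ofReal |ξ⁻¹| *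
        ENNReal.ofReal (min 1 (‖V‖ ^ 2 * (L * ξ) ^ 2) / ‖V‖ ^ 3)) := by
        apply lintegral_lintegral_swap
        apply Measurable.aemeasurable
        unfold Function.uncurry
        have := hhc.measurable
        fun_prop
    _ ≤ ∫⁻ ξ, ‖H ξ‖ₑ ^ 2 * (c * ENNReal.ofReal C * ENNReal.ofReal L * ∫⁻ V, hkern V) := by
        apply lintegral_mono_ae
        have : ∀ᵐ ξ : ℝ, ξ ≠ 0 := by simp [ae_iff]
        filter_upwards [this] with ξ hξ
        rw [lintegral_const_mul _ (by fun_prop), lintegral_const_mul _ (by fun_prop),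
          hkern_scale (L * ξ) (by positivity), abs_mul, abs_of_pos hL, ENNReal.ofReal_mul hL.le]
        apply le_of_eq
        have : ENNReal.ofReal |ξ⁻¹| * ENNReal.ofReal |ξ| = 1 := by
          rw [← ENNReal.ofReal_mul (by positivity), ← abs_mul, inv_mul_cancel₀ hξ]; simp
        calc _ = (ENNReal.ofReal |ξ⁻¹| * ENNReal.ofReal |ξ|) * (c * ENNReal.ofReal C * ‖H ξ‖ₑ ^ 2 *
            ENNReal.ofReal L * ∫⁻ V, hkern V) := by ring
          _ = _ := by rw [this]; ring
    _ = (∫⁻ ξ, ‖H ξ‖ₑ ^ 2) * (c * ENNReal.ofReal C * ENNReal.ofReal L * ∫⁻ V, hkern V) := by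
        rw [lintegral_mul_const _ (hhc.measurable.enorm.pow_const 2)]
    _ < ⊤ := by
        have pl := hlp_planch (fun x => (h x : ℂ)) h1.ofReal h2.ofReal
        rw [hH, pl]
        have f1 : ∫⁻ x, ‖(h x : ℂ)‖ₑ ^ 2 < ⊤ := by
          have := h2.ofReal (K := ℂ)
          have h3 := this.eLpNorm_lt_top
          have h4 := eLpNorm_nnreal_pow_eq_lintegral (p := 2) (μ := volume) (f := fun x => (h x : ℂ)) (by norm_num)
          simp only [ENNReal.coe_ofNat, NNReal.coe_ofNat, ENNReal.rpow_ofNat] at h4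
          rw [← h4]
          exact ENNReal.pow_lt_top h3
        have := hkern_fin
        finiteness

theorem hE_cont {ψ v : ℝ → ℝ} (hψ : Continuous ψ) (hv : Continuous v)
    (α β : E2 →L[ℝ] ℝ) (a b : ℝ) : Continuous (fun P : E2 => hA ψ v (a + α P) (b + β P)) := by
  unfold hA
  refine continuous_parametric_integral_of_continuous (f := fun (P : E2) (s : ℝ) =>
    v (a + α P - (b + β P) * s) * ψ s) ?_ isCompact_Icc
  unfold Function.uncurry
  fun_prop

theorem hE_hasFDerivAt {ψ V v : ℝ → ℝ} (hψ : Continuous ψ) (hV : ∀ x, HasDerivAt V (v x) x)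
    (hv : Continuous v) {M : ℝ} (hM : ∀ x, |v x| ≤ M) (α β : E2 →L[ℝ] ℝ) (a b : ℝ) (P : E2) :
    HasFDerivAt (fun P : E2 => hA ψ V (a + α P) (b + β P))
      (hA ψ v (a + α P) (b + β P) • α - hA (fun s => s * ψ s) v (a + α P) (b + β P) • β) P := by
  have hVc : Continuous V := continuous_iff_continuousAt.2 fun x => (hV x).continuousAt
  obtain ⟨K, hK0, hK⟩ := hA_bdd hψ
  have hM0 : 0 ≤ M := (abs_nonneg _).trans (hM 0)
  have key := hasFDerivAt_integral_of_dominated_of_fderiv_le (𝕜 := ℝ) (μ := volume.restrict (Icc (0:ℝ) 1))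
    (F := fun (P : E2) (s : ℝ) => V (a + α P - (b + β P) * s) * ψ s)
    (F' := fun (P : E2) (s : ℝ) => (v (a + α P - (b + β P) * s) * ψ s) • (α - s • β))
    (x₀ := P) (s := univ) (bound := fun _ => M * K * (‖α‖ + ‖β‖)) Filter.univ_mem
    (Filter.Eventually.of_forall fun x => by
      apply Continuous.aestronglyMeasurable; fun_prop)
    (by apply Continuous.integrableOn_Icc; fun_prop)
    (by apply Continuous.aestronglyMeasurable; fun_prop)
    (by
      rw [ae_restrict_iff' measurableSet_Icc]
      refine Filter.Eventually.of_forall fun s hs x _ => ?_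
      rw [norm_smul, norm_mul]
      have h1 := hM (a + α x - (b + β x) * s)
      have h2 := hK s hs
      have h3 : ‖α - s • β‖ ≤ ‖α‖ + ‖β‖ := by
        refine (norm_sub_le _ _).trans ?_
        rw [norm_smul]
        have : ‖s‖ ≤ 1 := by rw [Real.norm_eq_abs, abs_of_nonneg hs.1]; exact hs.2
        nlinarith [norm_nonneg β]
      exact mul_le_mul (mul_le_mul h1 h2 (abs_nonneg _) hM0) h3 (norm_nonneg _) (by positivity))
    (integrable_const _)
    (Filter.Eventually.of_forall fun s x _ => by
      have e1 : HasFDerivAt (fun P : E2 => a + α P - (b + β P) * s) (α - s • β) x := by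
        have := (α.hasFDerivAt (x := x)).const_add a |>.sub (((β.hasFDerivAt (x := x)).const_add b).mul_const s)
        exact this
      have := ((hV _).comp_hasFDerivAt x e1).mul_const (ψ s)
      refine HasFDerivAt.congr_fderiv this ?_
      rw [smul_smul, mul_comm])
  refine HasFDerivAt.congr_fderiv key ?_
  symm
  unfold hA
  have i1 : Integrable (fun s => v (a + α P - (b + β P) * s) * ψ s) (volume.restrict (Icc (0:ℝ) 1)) := by
    apply Continuous.integrableOn_Icc; fun_prop
  have i2 : Integrable (fun s => v (a + α P - (b + β P) * s) * (s * ψ s)) (volume.restrict (Icc (0:ℝ) 1)) := by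
    apply Continuous.integrableOn_Icc; fun_prop
  have q1 := integral_smul_const (𝕜 := ℝ) (μ := volume.restrict (Icc (0:ℝ) 1))
    (fun s => v (a + α P - (b + β P) * s) * ψ s) α
  have q2 := integral_smul_const (𝕜 := ℝ) (μ := volume.restrict (Icc (0:ℝ) 1))
    (fun s => v (a + α P - (b + β P) * s) * (s * ψ s)) β
  refine (congrArg₂ (· - ·) q1.symm q2.symm).trans ?_
  rw [← integral_sub (i1.smul_const α) (i2.smul_const β)]
  congr 1; ext1 s
  module

theorem hA_lin {ψ v : ℝ → ℝ} (hψ : Continuous ψ) {x y : ℝ}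
    (hi : ∀ ψ : ℝ → ℝ, Continuous ψ → IntegrableOn (fun s => v (x - y * s) * ψ s) (Icc (0:ℝ) 1)) (A B : ℝ) :
    hA (fun s => (A - B * s) * ψ s) v x y = hA ψ v x y * A - hA (fun s => s * ψ s) v x y * B := by
  unfold hA
  rw [← integral_mul_const, ← integral_mul_const, ← integral_sub ((hi _ hψ).mul_const _)
    ((hi _ (by fun_prop)).mul_const _)]
  congr 1; ext1 s
  ring

theorem hA_int_c {ψ v : ℝ → ℝ} (hψ : Continuous ψ) (hv : Continuous v) (x y : ℝ) :
    IntegrableOn (fun s => v (x - y * s) * ψ s) (Icc (0:ℝ) 1) := by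
  apply Continuous.integrableOn_Icc; fun_prop

theorem hE_fderiv {ψ V v : ℝ → ℝ} (hψ : Continuous ψ) (hV : ∀ x, HasDerivAt V (v x) x)
    (hv : Continuous v) {M : ℝ} (hM : ∀ x, |v x| ≤ M) (α β : E2 →L[ℝ] ℝ) (a b : ℝ) (P d : E2) :
    fderiv ℝ (fun P : E2 => hA ψ V (a + α P) (b + β P)) P d =
      hA (fun s => (α d - β d * s) * ψ s) v (a + α P) (b + β P) := by
  rw [(hE_hasFDerivAt hψ hV hv hM α β a b P).fderiv, hA_lin hψ (fun ψ hψ => hA_int_c hψ hv _ _)]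
  simp

theorem hE_contDiff {ψ V v : ℝ → ℝ} (hψ : Continuous ψ) (hV : ∀ x, HasDerivAt V (v x) x)
    (hv : Continuous v) {M : ℝ} (hM : ∀ x, |v x| ≤ M) (α β : E2 →L[ℝ] ℝ) (a b : ℝ) :
    ContDiff ℝ 1 (fun P : E2 => hA ψ V (a + α P) (b + β P)) := by
  rw [contDiff_one_iff_fderiv]
  refine ⟨fun P => (hE_hasFDerivAt hψ hV hv hM α β a b P).differentiableAt, ?_⟩
  have e : fderiv ℝ (fun P : E2 => hA ψ V (a + α P) (b + β P)) = fun P =>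
      (hA ψ v (a + α P) (b + β P) • α - hA (fun s => s * ψ s) v (a + α P) (b + β P) • β) :=
    funext fun P => (hE_hasFDerivAt hψ hV hv hM α β a b P).fderiv
  rw [e]
  have c1 := hE_cont hψ hv α β a b
  have c2 := hE_cont (ψ := fun s => s * ψ s) (by fun_prop) hv α β a b
  fun_prop

/-- L¹ bound in x -/
theorem hA_L1_x {ψ h : ℝ → ℝ} (hψ : Continuous ψ) (hm : Measurable h) {M : ℝ} (hM0 : 0 ≤ M)
    (hM : ∀ s ∈ Icc (0:ℝ) 1, |ψ s| ≤ M) (y : ℝ) :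
    ∫⁻ x, ‖hA ψ h x y‖ₑ ≤ ENNReal.ofReal M * ∫⁻ x, ‖h x‖ₑ := by
  have hψm := hψ.measurable
  calc ∫⁻ x, ‖hA ψ h x y‖ₑ
      ≤ ∫⁻ x, ∫⁻ s in Icc (0:ℝ) 1, ‖h (x - y * s) * ψ s‖ₑ := by
        gcongr with x
        exact enorm_integral_le_lintegral_enorm _
    _ = ∫⁻ s in Icc (0:ℝ) 1, ∫⁻ x, ‖h (x - y * s) * ψ s‖ₑ := by
        apply lintegral_lintegral_swap
        apply Measurable.aemeasurable
        unfold Function.uncurry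
        fun_prop
    _ ≤ ∫⁻ s in Icc (0:ℝ) 1, ENNReal.ofReal M * ∫⁻ x, ‖h x‖ₑ := by
        apply setLIntegral_mono measurable_const
        intro s hs
        simp only [enorm_mul]
        rw [lintegral_mul_const _ (by fun_prop), lintegral_sub_right_eq_self (fun x => ‖h x‖ₑ), mul_comm]
        gcongr
        rw [Real.enorm_eq_ofReal_abs]
        exact ENNReal.ofReal_le_ofReal (hM s hs)
    _ = _ := by simp

theorem hlp_iic_deriv {g : ℝ → ℝ} (hg : Continuous g) (hi : Integrable g) (x : ℝ) :
    HasDerivAt (fun x => ∫ t in Iic x, g t) (g x) x := by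
  have e : (fun x => ∫ t in Iic x, g t) = fun x => (∫ t in Iic (0:ℝ), g t) + ∫ t in (0:ℝ)..x, g t := by
    ext x
    rw [← intervalIntegral.integral_Iic_sub_Iic hi.integrableOn hi.integrableOn]
    ring
  rw [e]
  exact (intervalIntegral.integral_hasDerivAt_right (hg.intervalIntegrable _ _)
    hg.stronglyMeasurable.stronglyMeasurableAtFilter hg.continuousAt).const_add _

/-- weak derivative of C¹ functions -/
theorem hlp_ibp (u φ : E2 → ℝ) (hu : ContDiff ℝ 1 u) (hφ : ContDiff ℝ (⊤ : ℕ∞) φ) (hc : HasCompactSupport φ)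
    (d : E2) : ∫ P, u P * fderiv ℝ φ P d = - ∫ P, fderiv ℝ u P d * φ P := by
  have hφ1 : ContDiff ℝ 1 φ := hφ.of_le (by exact_mod_cast le_top)
  have c1 : Continuous (fun P => fderiv ℝ u P d) := (hu.continuous_fderiv (by norm_num)).clm_apply continuous_const
  have c2 : Continuous (fun P => fderiv ℝ φ P d) := (hφ1.continuous_fderiv (by norm_num)).clm_apply continuous_const
  have s2 : HasCompactSupport (fun P => fderiv ℝ φ P d) := hc.fderiv_apply (𝕜 := ℝ) d
  apply integral_mul_fderiv_eq_neg_fderiv_mul_of_integrable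
  · exact (c1.mul hφ.continuous).integrable_of_hasCompactSupport hc.mul_left
  · exact (hu.continuous.mul c2).integrable_of_hasCompactSupport s2.mul_left
  · exact (hu.continuous.mul hφ.continuous).integrable_of_hasCompactSupport hc.mul_left
  · exact fun x _ => hu.differentiable (by norm_num) x
  · exact fun x _ => hφ1.differentiable (by norm_num) x

theorem hlp_strip (α β : E2 →L[ℝ] ℝ) (hind : ∀ d, α d = 0 → β d = 0 → d = 0) (a b : ℝ)
    {S : Set E2} (hS : Bornology.IsBounded S) :
    ∃ c : ENNReal, c < ⊤ ∧ ∀ G : ℝ × ℝ → ENNReal, Measurable G → ∀ K : ENNReal, (∀ y, ∫⁻ x, G (x, y) ≤ K) →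
      ∫⁻ P in S, G (a + α P, b + β P) ≤ c * K := by
  obtain ⟨c, hc, hF⟩ := hlp_coord α β hind a b
  obtain ⟨R, hR⟩ : ∃ R : ℝ, ∀ P ∈ S, |b + β P| ≤ R := by
    obtain ⟨r, hr⟩ := hS.subset_closedBall 0
    have hcc : Continuous fun P : E2 => b + β P := by fun_prop
    obtain ⟨R, hR⟩ := (isCompact_closedBall (0:E2) r).exists_bound_of_continuousOn hcc.continuousOn
    exact ⟨R, fun P hP => hR P (hr hP)⟩
  refine ⟨c * volume (Icc (-R) R), by simp; finiteness, fun G hG K hK => ?_⟩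
  have hT : MeasurableSet {q : ℝ × ℝ | q.2 ∈ Icc (-R) R} := measurable_snd measurableSet_Icc
  have hT2 : MeasurableSet {P : E2 | b + β P ∈ Icc (-R) R} :=
    (by fun_prop : Measurable fun P : E2 => b + β P) measurableSet_Icc
  calc ∫⁻ P in S, G (a + α P, b + β P) ≤ ∫⁻ P in {P : E2 | b + β P ∈ Icc (-R) R}, G (a + α P, b + β P) := by
        apply lintegral_mono_set
        intro P hP
        exact abs_le.1 (hR P hP)
    _ = ∫⁻ P : E2, ({q : ℝ × ℝ | q.2 ∈ Icc (-R) R}.indicator G) (a + α P, b + β P) := by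
        rw [← lintegral_indicator hT2]
        rfl
    _ = c * ∫⁻ y, ∫⁻ x, ({q : ℝ × ℝ | q.2 ∈ Icc (-R) R}.indicator G) (x, y) := hF _ (hG.indicator hT)
    _ ≤ c * ∫⁻ y, (Icc (-R) R).indicator (fun _ => K) y := by
        refine mul_le_mul_right (lintegral_mono fun y => ?_) c
        by_cases hy : y ∈ Icc (-R) R
        · rw [indicator_of_mem hy]
          refine le_trans (lintegral_mono fun x => ?_) (hK y)
          exact indicator_le_self _ _ _
        · rw [indicator_of_notMem hy]
          have : ∀ x, ({q : ℝ × ℝ | q.2 ∈ Icc (-R) R}.indicator G) (x, y) = 0 := fun x =>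
            indicator_of_notMem (by exact hy) _
          simp only [this, lintegral_zero, le_refl]
    _ = _ := by
        rw [lintegral_indicator_const measurableSet_Icc]
        ring

theorem hE_L2on {ψ h : ℝ → ℝ} (hψ : Continuous ψ) (hm : Measurable h)
    (h2 : MemLp h 2 volume) (α β : E2 →L[ℝ] ℝ) (hind : ∀ d, α d = 0 → β d = 0 → d = 0) (a b : ℝ)
    {S : Set E2} (hS : Bornology.IsBounded S) : L2on S (fun P : E2 => hA ψ h (a + α P) (b + β P)) := by
  obtain ⟨c, hc, hF⟩ := hlp_strip α β hind a b hS
  obtain ⟨M, hM0, hM⟩ := hA_L2_x hψ hm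
  refine ⟨(hE_sm hψ hm α β a b).aestronglyMeasurable, ?_⟩
  have e3 := eLpNorm_nnreal_pow_eq_lintegral (μ := volume.restrict S)
    (f := (fun P : E2 => hA ψ h (a + α P) (b + β P))) (p := 2) (by norm_num)
  have e4 := eLpNorm_nnreal_pow_eq_lintegral (μ := (volume : Measure ℝ)) (f := h) (p := 2) (by norm_num)
  simp only [ENNReal.coe_ofNat, NNReal.coe_ofNat, ENNReal.rpow_ofNat] at e3 e4
  have := hF (fun q => ‖hA ψ h q.1 q.2‖ₑ ^ 2) ((hA_sm hψ hm).measurable.enorm.pow_const 2) _ hM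
  rw [← e3, ← e4] at this
  have fin : c * (ENNReal.ofReal M * eLpNorm h 2 volume ^ 2) < ⊤ := by
    have := h2.eLpNorm_lt_top
    finiteness
  have := this.trans_lt fin
  by_contra hcon
  rw [not_lt, top_le_iff] at hcon
  rw [hcon] at this
  simp at this

theorem hE_L1loc {ψ : ℝ → ℝ} (hψ : Continuous ψ) (α β : E2 →L[ℝ] ℝ)
    (hind : ∀ d, α d = 0 → β d = 0 → d = 0) (a b : ℝ) {φ : E2 → ℝ} (hφ : Continuous φ)
    (hc : HasCompactSupport φ) : ∃ C : ℝ, 0 ≤ C ∧ ∀ h : ℝ → ℝ, Measurable h → Integrable h →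
      Integrable (fun P : E2 => hA ψ h (a + α P) (b + β P) * φ P) ∧
      |∫ P : E2, hA ψ h (a + α P) (b + β P) * φ P| ≤ C * ∫ x, ‖h x‖ := by
  obtain ⟨c, hcc, hF⟩ := hlp_strip α β hind a b hc.isBounded
  obtain ⟨M, hM0, hM⟩ := hA_bdd hψ
  obtain ⟨B, hB⟩ := hc.exists_bound_of_continuous hφ
  have hB0 : 0 ≤ B := (norm_nonneg _).trans (hB 0)
  refine ⟨B * c.toReal * M, by positivity, fun h hm h1 => ?_⟩
  have key := hF (fun q => ‖hA ψ h q.1 q.2‖ₑ) ((hA_sm hψ hm).measurable.enorm) _ (hA_L1_x hψ hm hM0 hM)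
  have hfin : ∫⁻ x, ‖h x‖ₑ = ENNReal.ofReal (∫ x, ‖h x‖) := (ofReal_integral_norm_eq_lintegral_enorm h1).symm
  have b2 : ∫⁻ P : E2, ‖hA ψ h (a + α P) (b + β P) * φ P‖ₑ ≤ ENNReal.ofReal (B * c.toReal * M * ∫ x, ‖h x‖) := by
    calc _ ≤ ∫⁻ P : E2, (tsupport φ).indicator (fun P => ENNReal.ofReal B * ‖hA ψ h (a + α P) (b + β P)‖ₑ) P := by
          apply lintegral_mono
          intro P
          by_cases hP : P ∈ tsupport φ
          · rw [indicator_of_mem hP]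
            simp only [enorm_mul]
            rw [mul_comm]
            gcongr
            rw [Real.enorm_eq_ofReal_abs]
            exact ENNReal.ofReal_le_ofReal (hB P)
          · simp [image_eq_zero_of_notMem_tsupport hP]
      _ = ENNReal.ofReal B * ∫⁻ P in tsupport φ, ‖hA ψ h (a + α P) (b + β P)‖ₑ := by
          rw [lintegral_indicator (isClosed_tsupport φ).measurableSet, lintegral_const_mul' _ _ (by finiteness)]
      _ ≤ ENNReal.ofReal B * (c * (ENNReal.ofReal M * ∫⁻ x, ‖h x‖ₑ)) := by gcongr
      _ = _ := by
          rw [hfin, ENNReal.ofReal_mul (by positivity), ENNReal.ofReal_mul (by positivity), ENNReal.ofReal_mul hB0,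
            ENNReal.ofReal_toReal hcc.ne]
          ring
  have hmm : AEStronglyMeasurable (fun P : E2 => hA ψ h (a + α P) (b + β P) * φ P) volume :=
    ((hE_sm hψ hm α β a b).mul hφ.stronglyMeasurable).aestronglyMeasurable
  refine ⟨⟨hmm, b2.trans_lt (by finiteness)⟩, ?_⟩
  have := (enorm_integral_le_lintegral_enorm _).trans b2
  rw [Real.enorm_eq_ofReal_abs] at this
  refine (ENNReal.ofReal_le_ofReal_iff ?_).1 this
  have : 0 ≤ ∫ x, ‖h x‖ := integral_nonneg fun _ => norm_nonneg _
  positivity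

theorem hE_weak {ψ h : ℝ → ℝ} (hψ : Continuous ψ) (hm : Measurable h) (h1 : Integrable h)
    (α β : E2 →L[ℝ] ℝ) (hind : ∀ d, α d = 0 → β d = 0 → d = 0) (a b : ℝ)
    {v : ℝ → ℝ} (hv : ∀ x, v x = ∫ t in Iic x, h t) (hvc : Continuous v)
    {φ : E2 → ℝ} (hφ : ContDiff ℝ (⊤ : ℕ∞) φ) (hc : HasCompactSupport φ) (d : E2) :
    ∫ P : E2, hA ψ v (a + α P) (b + β P) * fderiv ℝ φ P d =
      - ∫ P : E2, hA (fun s => (α d - β d * s) * ψ s) h (a + α P) (b + β P) * φ P := by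
  have hφ1 : ContDiff ℝ 1 φ := hφ.of_le (by exact_mod_cast le_top)
  have c2 : Continuous (fun P => fderiv ℝ φ P d) := (hφ1.continuous_fderiv (by norm_num)).clm_apply continuous_const
  have s2 : HasCompactSupport (fun P => fderiv ℝ φ P d) := hc.fderiv_apply (𝕜 := ℝ) d
  have hκ : Continuous (fun s => (α d - β d * s) * ψ s) := by fun_prop
  obtain ⟨C, hC0, hC⟩ := hE_L1loc hκ α β hind a b hφ.continuous hc
  obtain ⟨M, hM0, hM⟩ := hA_bdd hψ
  set D := ∫ P : E2, |fderiv ℝ φ P d| with hD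
  have hD0 : 0 ≤ D := integral_nonneg fun _ => abs_nonneg _
  rw [← sub_eq_zero, sub_neg_eq_add]
  rw [← abs_nonpos_iff]
  have main : ∀ ε > 0, |(∫ P : E2, hA ψ v (a + α P) (b + β P) * fderiv ℝ φ P d) +
      ∫ P : E2, hA (fun s => (α d - β d * s) * ψ s) h (a + α P) (b + β P) * φ P| ≤ (M * D + C) * ε := by
    intro ε hε
    obtain ⟨g, hgs, hgε, hgc, hgi⟩ := h1.exists_hasCompactSupport_integral_sub_le hε
    set w : ℝ → ℝ := fun x => ∫ t in Iic x, g t with hw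
    have hwd := hlp_iic_deriv hgc hgi
    have hwc : Continuous w := continuous_iff_continuousAt.2 fun x => (hwd x).continuousAt
    obtain ⟨K, hK⟩ := hgs.exists_bound_of_continuous hgc
    have C1 := hE_contDiff hψ hwd hgc hK α β a b
    have ib := hlp_ibp _ φ C1 hφ hc d
    simp only [hE_fderiv hψ hwd hgc hK α β a b] at ib
    have hvw : ∀ x, |v x - w x| ≤ ε := by
      intro x
      rw [hv, hw]
      simp only []
      rw [← integral_sub h1.integrableOn hgi.integrableOn, ← Real.norm_eq_abs]
      refine (norm_integral_le_integral_norm _).trans (le_trans ?_ hgε)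
      exact setIntegral_le_integral (h1.sub hgi).norm (Filter.Eventually.of_forall fun _ => norm_nonneg _)
    have d1 : ∀ x y, |hA ψ v x y - hA ψ w x y| ≤ ε * M := by
      intro x y
      unfold hA
      rw [← integral_sub (hA_int_c hψ hvc x y) (hA_int_c hψ hwc x y)]
      have := norm_setIntegral_le_of_norm_le_const (μ := volume) (s := Icc (0:ℝ) 1) (C := ε * M)
        (f := fun s => v (x - y * s) * ψ s - w (x - y * s) * ψ s) (by simp) (by
          intro s hs
          rw [← sub_mul, norm_mul]
          exact mul_le_mul (hvw _) (hM s hs) (norm_nonneg _) hε.le)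
      simpa using this
    have iv : Integrable (fun P : E2 => hA ψ v (a + α P) (b + β P) * fderiv ℝ φ P d) :=
      ((hE_cont hψ hvc α β a b).mul c2).integrable_of_hasCompactSupport s2.mul_left
    have iw : Integrable (fun P : E2 => hA ψ w (a + α P) (b + β P) * fderiv ℝ φ P d) :=
      ((hE_cont hψ hwc α β a b).mul c2).integrable_of_hasCompactSupport s2.mul_left
    have t1 : |(∫ P : E2, hA ψ v (a + α P) (b + β P) * fderiv ℝ φ P d) -
        ∫ P : E2, hA ψ w (a + α P) (b + β P) * fderiv ℝ φ P d| ≤ M * D * ε := by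
      rw [← integral_sub iv iw, ← Real.norm_eq_abs]
      refine (norm_integral_le_integral_norm _).trans ?_
      calc _ ≤ ∫ P : E2, (ε * M) * |fderiv ℝ φ P d| := by
            apply integral_mono_of_nonneg (Filter.Eventually.of_forall fun _ => norm_nonneg _)
            · exact (c2.integrable_of_hasCompactSupport s2).norm.const_mul _
            · refine Filter.Eventually.of_forall fun P => ?_
              simp only []
              rw [← sub_mul, norm_mul]
              exact mul_le_mul_of_nonneg_right (d1 _ _) (norm_nonneg _)
        _ = M * D * ε := by rw [integral_const_mul]; ring
    have ih := (hC h hm h1).1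
    have ig := (hC g hgc.measurable hgi).1
    have t2 : |(∫ P : E2, hA (fun s => (α d - β d * s) * ψ s) h (a + α P) (b + β P) * φ P) -
        ∫ P : E2, hA (fun s => (α d - β d * s) * ψ s) g (a + α P) (b + β P) * φ P| ≤ C * ε := by
      rw [← integral_sub ih ig]
      have := (hC (fun x => h x - g x) (hm.sub hgc.measurable) (h1.sub hgi)).2
      refine le_trans (le_of_eq ?_) (this.trans (by gcongr))
      congr 2; ext P
      rw [← sub_mul]
      congr 1
      unfold hA
      rw [← integral_sub (hA_int_s hκ h1 _ _) (hA_int_s hκ hgi _ _)]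
      congr 1; ext s
      ring
    rw [ib] at t1
    have := abs_add_le ((∫ P : E2, hA ψ v (a + α P) (b + β P) * fderiv ℝ φ P d) -
       -∫ P : E2, hA (fun s => (α d - β d * s) * ψ s) g (a + α P) (b + β P) * φ P)
       ((∫ P : E2, hA (fun s => (α d - β d * s) * ψ s) h (a + α P) (b + β P) * φ P) -
        ∫ P : E2, hA (fun s => (α d - β d * s) * ψ s) g (a + α P) (b + β P) * φ P)
    calc _ ≤ _ := le_of_eq (by congr 1; ring)
      _ ≤ _ := this
      _ ≤ _ := by linarith
  by_contra hcon
  push Not at hcon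
  set X := |(∫ P : E2, hA ψ v (a + α P) (b + β P) * fderiv ℝ φ P d) +
      ∫ P : E2, hA (fun s => (α d - β d * s) * ψ s) h (a + α P) (b + β P) * φ P|
  have hp : 0 < M * D + C + 1 := by positivity
  have := main (X / (M * D + C + 1)) (by positivity)
  rw [mul_div_assoc', le_div_iff₀ hp] at this
  nlinarith

def GLs (Ω : Set E2) (u : E2 → ℝ) : Prop := L2on Ω u ∧ GagH12 Ω u

theorem hL2_cont {Ω : Set E2} (hΩ : Bornology.IsBounded Ω) {u : E2 → ℝ} (hu : Continuous u) : L2on Ω u := by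
  obtain ⟨r, hr⟩ := hΩ.subset_closedBall 0
  obtain ⟨M, hM⟩ := (isCompact_closedBall (0:E2) r).exists_bound_of_continuousOn hu.continuousOn
  have fin : IsFiniteMeasure (volume.restrict (Metric.closedBall (0:E2) r)) :=
    ⟨by rw [Measure.restrict_apply_univ]; exact (isCompact_closedBall (0:E2) r).measure_lt_top⟩
  have : MemLp u 2 (volume.restrict (Metric.closedBall (0:E2) r)) :=
    MemLp.of_bound hu.aestronglyMeasurable M (by
      rw [ae_restrict_iff' Metric.isClosed_closedBall.measurableSet]
      exact Filter.Eventually.of_forall hM)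
  exact this.mono_measure (Measure.restrict_mono hr le_rfl)

theorem gag_meas {Ω : Set E2} {u : E2 → ℝ} (hu : AEStronglyMeasurable u (volume.restrict Ω)) :
    AEStronglyMeasurable (fun q : E2 × E2 => (u q.1 - u q.2) ^ 2 / ‖q.1 - q.2‖ ^ (2 + 1))
      ((volume.restrict Ω).prod (volume.restrict Ω)) := by
  have m : Measurable (fun q : E2 × E2 => ‖q.1 - q.2‖ ^ (2 + 1)) := by fun_prop
  exact ((hu.comp_fst.sub hu.comp_snd).pow 2).div₀ m.aestronglyMeasurable

theorem GLs_add {Ω : Set E2} {u v : E2 → ℝ} (hu : GLs Ω u) (hv : GLs Ω v) : GLs Ω (fun P => u P + v P) := by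
  have hm : L2on Ω (fun P => u P + v P) := MemLp.add hu.1 hv.1
  refine ⟨hm, ?_⟩
  have := (hu.2.const_mul 2).add (hv.2.const_mul 2)
  refine Integrable.mono' this (gag_meas hm.1) (Filter.Eventually.of_forall fun q => ?_)
  rw [Real.norm_eq_abs, abs_of_nonneg (by positivity)]
  simp only [Pi.add_apply]
  rw [mul_div_assoc', mul_div_assoc', ← add_div]
  gcongr
  nlinarith [sq_nonneg ((u q.1 - u q.2) - (v q.1 - v q.2))]

theorem hlp_c1_bound {Ω : Set E2} (hΩ : Bornology.IsBounded Ω) {c : E2 → ℝ} (hc : ContDiff ℝ 1 c) :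
    ∃ M : ℝ, 0 ≤ M ∧ (∀ P ∈ Ω, |c P| ≤ M) ∧ ∀ P ∈ Ω, ∀ Q ∈ Ω, (c P - c Q) ^ 2 ≤ M * min 1 (‖P - Q‖ ^ 2) := by
  obtain ⟨r, hr⟩ := hΩ.subset_closedBall 0
  have hk := isCompact_closedBall (0:E2) r
  obtain ⟨M, hM⟩ := hk.exists_bound_of_continuousOn hc.continuous.continuousOn
  obtain ⟨L, hL⟩ := hk.exists_bound_of_continuousOn (hc.continuous_fderiv (by norm_num)).continuousOn
  have lip : ∀ P ∈ Ω, ∀ Q ∈ Ω, |c P - c Q| ≤ L * ‖P - Q‖ := fun P hP Q hQ =>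
    (convex_closedBall (0:E2) r).norm_image_sub_le_of_norm_fderiv_le
      (fun x _ => hc.differentiable (by norm_num) x) hL (hr hQ) (hr hP)
  refine ⟨|M| + 4 * M ^ 2 + L ^ 2, by positivity, fun P hP => ?_, fun P hP Q hQ => ?_⟩
  · have := hM P (hr hP)
    rw [Real.norm_eq_abs] at this
    have := le_abs_self M
    nlinarith [sq_nonneg M, sq_nonneg L]
  · have l1 := lip P hP Q hQ
    have b1 := hM P (hr hP)
    have b2 := hM Q (hr hQ)
    rw [Real.norm_eq_abs] at b1 b2
    have n0 : 0 ≤ ‖P - Q‖ ^ 2 := by positivity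
    have k1 : (c P - c Q) ^ 2 ≤ L ^ 2 * ‖P - Q‖ ^ 2 := by
      rw [← sq_abs, ← mul_pow]; gcongr
    have k2 : (c P - c Q) ^ 2 ≤ 4 * M ^ 2 := by
      have : |c P - c Q| ≤ 2 * M := (abs_sub _ _).trans (by linarith)
      rw [← sq_abs]; nlinarith [abs_nonneg (c P - c Q)]
    rcases le_total 1 (‖P - Q‖ ^ 2) with h | h
    · rw [min_eq_left h]; nlinarith [abs_nonneg M, sq_nonneg L]
    · rw [min_eq_right h]
      have := mul_nonneg (abs_nonneg M) n0
      have := mul_nonneg (sq_nonneg M) n0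
      nlinarith

theorem GLs_mul {Ω : Set E2} (hΩ : Bornology.IsBounded Ω) (hΩm : MeasurableSet Ω) {c u : E2 → ℝ}
    (hc : ContDiff ℝ 1 c) (hu : GLs Ω u) :
    GLs Ω (fun P => c P * u P) := by
  obtain ⟨M, hM0, hMb, hML⟩ := hlp_c1_bound hΩ hc
  have hm : L2on Ω (fun P => c P * u P) := by
    refine MemLp.of_le_mul (c := M) hu.1 (hc.continuous.aestronglyMeasurable.mul hu.1.1) ?_
    rw [ae_restrict_iff' hΩm]
    refine Filter.Eventually.of_forall fun P hP => ?_
    rw [norm_mul]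
    exact mul_le_mul_of_nonneg_right (hMb P hP) (norm_nonneg _)
  refine ⟨hm, ?_⟩
  -- the kernel term
  have ker : Integrable (fun q : E2 × E2 => u q.2 ^ 2 * (min 1 (‖q.1 - q.2‖ ^ 2) / ‖q.1 - q.2‖ ^ 3))
      ((volume.restrict Ω).prod (volume.restrict Ω)) := by
    have m1 : Measurable (fun q : E2 × E2 => (min 1 (‖q.1 - q.2‖ ^ 2) / ‖q.1 - q.2‖ ^ 3)) := by fun_prop
    have am : AEStronglyMeasurable (fun q : E2 × E2 => u q.2 ^ 2 * (min 1 (‖q.1 - q.2‖ ^ 2) / ‖q.1 - q.2‖ ^ 3))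
      ((volume.restrict Ω).prod (volume.restrict Ω)) :=
      (hu.1.1.comp_snd.pow 2).mul m1.aestronglyMeasurable
    refine ⟨am, ?_⟩
    unfold HasFiniteIntegral
    rw [lintegral_prod_symm _ am.enorm]
    calc _ ≤ ∫⁻ Q in Ω, ‖u Q‖ₑ ^ 2 * ∫⁻ V, hkern V := by
          apply lintegral_mono
          intro Q
          simp only []
          calc _ ≤ ∫⁻ P : E2, ‖u Q‖ₑ ^ 2 * hkern (P - Q) := by
                refine le_trans (lintegral_mono fun P => le_of_eq ?_) (setLIntegral_le_lintegral Ω _)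
                rw [enorm_mul, enorm_pow, hkern, Real.enorm_eq_ofReal (r := min 1 (‖P - Q‖ ^ 2) / _) (by positivity)]
            _ = _ := by
                rw [lintegral_const_mul' _ _ (by finiteness), lintegral_sub_right_eq_self hkern]
      _ = (∫⁻ Q in Ω, ‖u Q‖ₑ ^ 2) * ∫⁻ V, hkern V := lintegral_mul_const' _ _ hkern_fin.ne
      _ < ⊤ := by
          have h4 := eLpNorm_nnreal_pow_eq_lintegral (p := 2) (μ := volume.restrict Ω) (f := u) (by norm_num)
          simp only [ENNReal.coe_ofNat, NNReal.coe_ofNat, ENNReal.rpow_ofNat] at h4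
          rw [← h4]
          have := hu.1.eLpNorm_lt_top
          have := hkern_fin
          finiteness
  have := (hu.2.const_mul (2 * M ^ 2)).add (ker.const_mul (2 * M))
  refine Integrable.mono' this (gag_meas hm.1) ?_
  rw [Measure.prod_restrict, ae_restrict_iff' (hΩm.prod hΩm)]
  refine Filter.Eventually.of_forall fun q hq => ?_
  rw [Real.norm_eq_abs, abs_of_nonneg (by positivity)]
  simp only [Pi.add_apply]
  have e : 2 * M * (u q.2 ^ 2 * (min 1 (‖q.1 - q.2‖ ^ 2) / ‖q.1 - q.2‖ ^ 3)) =
    2 * M * (u q.2 ^ 2 * (min 1 (‖q.1 - q.2‖ ^ 2))) / ‖q.1 - q.2‖ ^ (2 + 1) := by ring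
  rw [e, mul_div_assoc', ← add_div]
  gcongr
  have k1 := hML q.1 hq.1 q.2 hq.2
  have k2 := hMb q.1 hq.1
  have k3 : (c q.1) ^ 2 ≤ M ^ 2 := by rw [← sq_abs]; gcongr
  have k4 := mul_le_mul_of_nonneg_left k1 (sq_nonneg (u q.2))
  have k5 := mul_le_mul_of_nonneg_right k3 (sq_nonneg (u q.1 - u q.2))
  nlinarith [sq_nonneg (c q.1 * (u q.1 - u q.2) - u q.2 * (c q.1 - c q.2))]

theorem GLs_one {Ω : Set E2} (hΩ : Bornology.IsBounded Ω) : GLs Ω (fun _ => 1) := by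
  refine ⟨hL2_cont hΩ continuous_const, ?_⟩
  unfold GagH12
  simp

theorem GLs_C1 {Ω : Set E2} (hΩ : Bornology.IsBounded Ω) (hΩm : MeasurableSet Ω) {c : E2 → ℝ}
    (hc : ContDiff ℝ 1 c) : GLs Ω c := by
  simpa using GLs_mul hΩ hΩm hc (GLs_one hΩ)

theorem hlp_setint {Ω : Set E2} {φ u : E2 → ℝ} (hs : tsupport φ ⊆ Ω) :
    ∫ P in Ω, u P * φ P = ∫ P, u P * φ P := by
  apply setIntegral_eq_integral_of_forall_compl_eq_zero
  intro P hP
  rw [image_eq_zero_of_notMem_tsupport (fun h => hP (hs h)), mul_zero]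

theorem hlp_tsd {φ : E2 → ℝ} (d : E2) : tsupport (fun P => fderiv ℝ φ P d) ⊆ tsupport φ :=
  tsupport_fderiv_apply_subset ℝ d

theorem weak_C1 {Ω : Set E2} {u : E2 → ℝ} (hu : ContDiff ℝ 1 u) (d : E2) :
    IsWeakD Ω u (fun P => fderiv ℝ u P d) d := by
  intro φ hφ hc hs
  rw [hlp_setint hs, hlp_setint ((hlp_tsd d).trans hs)]
  exact hlp_ibp u φ hu hφ hc d

theorem L2_int_mul {Ω : Set E2} {φ u : E2 → ℝ} (hΩ : Bornology.IsBounded Ω) (hu : L2on Ω u) (hφ : Continuous φ) :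
    Integrable (fun P => u P * φ P) (volume.restrict Ω) := MemLp.integrable_mul hu (hL2_cont hΩ hφ)

theorem weak_add {Ω : Set E2} (hΩ : Bornology.IsBounded Ω) {u v u' v' : E2 → ℝ} {d : E2}
    (hu : L2on Ω u) (hv : L2on Ω v) (hu' : L2on Ω u') (hv' : L2on Ω v') 
    (h1 : IsWeakD Ω u u' d) (h2 : IsWeakD Ω v v' d) :
    IsWeakD Ω (fun P => u P + v P) (fun P => u' P + v' P) d := by
  intro φ hφ hc hs
  have c2 : Continuous (fun P => fderiv ℝ φ P d) := (hφ.continuous_fderiv (by simp)).clm_apply continuous_const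
  simp only [add_mul]
  rw [integral_add (L2_int_mul hΩ hu c2) (L2_int_mul hΩ hv c2), h1 φ hφ hc hs, h2 φ hφ hc hs,
    integral_add (L2_int_mul hΩ hu' hφ.continuous) (L2_int_mul hΩ hv' hφ.continuous)]
  ring

theorem weak_mul {Ω : Set E2} (hΩ : Bornology.IsBounded Ω) {u u' c : E2 → ℝ} {d : E2}
    (hu : L2on Ω u) (hu' : L2on Ω u') (hcs : ContDiff ℝ (⊤ : ℕ∞) c)
    (h1 : IsWeakD Ω u u' d) :
    IsWeakD Ω (fun P => c P * u P) (fun P => c P * u' P + fderiv ℝ c P d * u P) d := by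
  intro φ hφ hc hs
  have c2 : Continuous (fun P => fderiv ℝ φ P d) := (hφ.continuous_fderiv (by simp)).clm_apply continuous_const
  have c3 : Continuous (fun P => fderiv ℝ c P d) := (hcs.continuous_fderiv (by simp)).clm_apply continuous_const
  have key := h1 (fun P => c P * φ P) (hcs.mul hφ) hc.mul_left
    ((tsupport_mul_subset_right).trans hs)
  have e : ∀ P, fderiv ℝ (fun P => c P * φ P) P d = c P * fderiv ℝ φ P d + φ P * fderiv ℝ c P d := by
    intro P
    rw [fderiv_fun_mul (hcs.differentiable (by simp) P) (hφ.differentiable (by simp) P)]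
    simp
  simp only [e] at key
  have i1 : Integrable (fun P => u P * (c P * fderiv ℝ φ P d)) (volume.restrict Ω) :=
    L2_int_mul hΩ hu (hcs.continuous.mul c2)
  have i2 : Integrable (fun P => u P * (φ P * fderiv ℝ c P d)) (volume.restrict Ω) :=
    L2_int_mul hΩ hu (hφ.continuous.mul c3)
  have i3 : Integrable (fun P => u' P * (c P * φ P)) (volume.restrict Ω) :=
    L2_int_mul hΩ hu' (hcs.continuous.mul hφ.continuous)
  simp only [mul_add] at key
  rw [integral_add i1 i2] at key
  have g1 : ∀ P, c P * u P * fderiv ℝ φ P d = u P * (c P * fderiv ℝ φ P d) := fun P => by ring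
  have g2 : ∀ P, (c P * u' P + fderiv ℝ c P d * u P) * φ P = u' P * (c P * φ P) + u P * (φ P * fderiv ℝ c P d) :=
    fun P => by ring
  simp only [g1, g2]
  rw [integral_add i3 i2]
  linarith

def KK (Ω : Set E2) (ζ : E2 → ℝ) : Prop :=
  ContDiff ℝ 1 ζ ∧ ∀ d, GLs Ω (fun P => fderiv ℝ ζ P d) ∧
    ∀ d', ∃ H, GLs Ω H ∧ IsWeakD Ω (fun P => fderiv ℝ ζ P d) H d'

theorem KK_add {Ω : Set E2} (hΩ : Bornology.IsBounded Ω) {ζ η : E2 → ℝ} (hζ : KK Ω ζ) (hη : KK Ω η) :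
    KK Ω (fun P => ζ P + η P) := by
  refine ⟨hζ.1.add hη.1, fun d => ?_⟩
  have e : (fun P => fderiv ℝ (fun P => ζ P + η P) P d) = fun P => fderiv ℝ ζ P d + fderiv ℝ η P d := by
    ext P
    rw [fderiv_fun_add (hζ.1.differentiable (by simp) P) (hη.1.differentiable (by simp) P)]
    simp
  rw [e]
  obtain ⟨a1, a2⟩ := hζ.2 d
  obtain ⟨b1, b2⟩ := hη.2 d
  refine ⟨GLs_add a1 b1, fun d' => ?_⟩
  obtain ⟨H, h1, h2⟩ := a2 d'
  obtain ⟨H', h1', h2'⟩ := b2 d'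
  exact ⟨_, GLs_add h1 h1', weak_add hΩ a1.1 b1.1 h1.1 h1'.1 h2 h2'⟩

theorem KK_mul {Ω : Set E2} (hΩ : Bornology.IsBounded Ω) (hΩm : MeasurableSet Ω) {ζ c : E2 → ℝ}
    (hc : ContDiff ℝ (⊤ : ℕ∞) c) (hζ : KK Ω ζ) : KK Ω (fun P => c P * ζ P) := by
  have hc1 : ContDiff ℝ 1 c := hc.of_le (by exact_mod_cast le_top)
  have hcd : ∀ d, ContDiff ℝ (⊤ : ℕ∞) (fun P => fderiv ℝ c P d) := fun d =>
    (hc.fderiv_right (m := ((⊤ : ℕ∞) : WithTop ℕ∞)) (by simp)).clm_apply contDiff_const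
  have hcd1 : ∀ d, ContDiff ℝ 1 (fun P => fderiv ℝ c P d) := fun d => (hcd d).of_le (by exact_mod_cast le_top)
  have hcdd : ∀ d d', ContDiff ℝ 1 (fun P => fderiv ℝ (fun P => fderiv ℝ c P d) P d') := fun d d' =>
    (((hcd d).fderiv_right (m := ((⊤ : ℕ∞) : WithTop ℕ∞)) (by simp)).clm_apply contDiff_const).of_le
      (by exact_mod_cast le_top)
  refine ⟨hc1.mul hζ.1, fun d => ?_⟩
  have e : (fun P => fderiv ℝ (fun P => c P * ζ P) P d) = fun P => c P * fderiv ℝ ζ P d + fderiv ℝ c P d * ζ P := by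
    ext P
    rw [fderiv_fun_mul (hc1.differentiable (by simp) P) (hζ.1.differentiable (by simp) P)]
    simp; ring
  rw [e]
  obtain ⟨a1, a2⟩ := hζ.2 d
  have gz := GLs_C1 hΩ hΩm hζ.1
  have g1 := GLs_mul hΩ hΩm hc1 a1
  have g2 := GLs_mul hΩ hΩm (hcd1 d) gz
  refine ⟨GLs_add g1 g2, fun d' => ?_⟩
  obtain ⟨H, h1, h2⟩ := a2 d'
  have w1 := weak_mul hΩ a1.1 h1.1 hc h2
  have w2 := weak_mul hΩ gz.1 (hζ.2 d').1.1 (hcd d) (weak_C1 hζ.1 d')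
  have l1 := GLs_add (GLs_mul hΩ hΩm hc1 h1) (GLs_mul hΩ hΩm (hcd1 d') a1)
  have l2 := GLs_add (GLs_mul hΩ hΩm (hcd1 d) (hζ.2 d').1) (GLs_mul hΩ hΩm 
    (hcdd d d') gz)
  exact ⟨_, GLs_add l1 l2, weak_add hΩ g1.1 g2.1 l1.1 l2.1 w1 w2⟩

theorem KK_smooth {Ω : Set E2} (hΩ : Bornology.IsBounded Ω) (hΩm : MeasurableSet Ω) {c : E2 → ℝ}
    (hc : ContDiff ℝ (⊤ : ℕ∞) c) : KK Ω c := by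
  have one : KK Ω (fun _ => 1) := by
    refine ⟨contDiff_const, fun d => ?_⟩
    have e : (fun P : E2 => fderiv ℝ (fun _ : E2 => (1:ℝ)) P d) = fun _ => 0 := by ext P; simp
    rw [e]
    have z : GLs Ω (fun _ => 0) := GLs_C1 hΩ hΩm contDiff_const
    refine ⟨z, fun d' => ⟨fun _ => 0, z, ?_⟩⟩
    intro φ _ _ _
    simp
  simpa using KK_mul hΩ hΩm hc one

theorem KK_H52 {Ω : Set E2} (hΩ : Bornology.IsBounded Ω) {ζ : E2 → ℝ}
    (h : KK Ω ζ) : MemH52 Ω ζ := by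
  have h2 := fun d d' => (h.2 d).2 d'
  choose H hH using h2
  refine ⟨fun d P => fderiv ℝ ζ P (EuclideanSpace.single d 1),
    fun d d' => H (EuclideanSpace.single d 1) (EuclideanSpace.single d' 1), ⟨hL2_cont hΩ h.1.continuous, ?_, ?_⟩, ?_⟩
  · exact fun d => ⟨(h.2 _).1.1, weak_C1 h.1 _⟩
  · exact fun d d' => ⟨(hH _ _).1.1, (hH _ _).2⟩
  · exact fun d d' => (hH _ _).1.2

theorem test_zero {φ : ℝ → ℝ} {S : Set ℝ} (hs : tsupport φ ⊆ S) {x : ℝ} (hx : x ∉ S) : φ x = 0 :=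
  image_eq_zero_of_notMem_tsupport fun h => hx (hs h)

theorem setint_test {φ u : ℝ → ℝ} {S : Set ℝ} (hs : tsupport φ ⊆ S) :
    ∫ x in S, u x * φ x = ∫ x, u x * φ x := by
  apply setIntegral_eq_integral_of_forall_compl_eq_zero
  intro x hx
  rw [test_zero hs hx, mul_zero]

theorem ibp_ac {u φ : ℝ → ℝ} (hu : AbsolutelyContinuousOnInterval u 0 1) (hφ : ContDiff ℝ (⊤ : ℕ∞) φ)
    (hs : tsupport φ ⊆ Ioo (0:ℝ) 1) :
    ∫ x in Ioo (0:ℝ) 1, u x * deriv φ x = - ∫ x in Ioo (0:ℝ) 1, deriv u x * φ x := by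
  have hφ1 : ContDiff ℝ 1 φ := hφ.of_le (by exact_mod_cast le_top)
  have h := hu.integral_mul_deriv_eq_deriv_mul (hφ1.contDiffOn (s := uIcc 0 1)).absolutelyContinuousOnInterval
  rw [test_zero hs (x := 0) (by simp), test_zero hs (x := 1) (by simp),
    intervalIntegral.integral_of_le zero_le_one, intervalIntegral.integral_of_le zero_le_one,
    integral_Ioc_eq_integral_Ioo, integral_Ioc_eq_integral_Ioo] at h
  rw [h]; ring

theorem dbr {k : ℝ → ℝ} (hk : ContinuousOn k (Icc 0 1))
    (h : ∀ φ : ℝ → ℝ, ContDiff ℝ (⊤ : ℕ∞) φ → HasCompactSupport φ → tsupport φ ⊆ Ioo (0:ℝ) 1 →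
      ∫ x in Ioo (0:ℝ) 1, k x * deriv φ x = 0) : ∀ x ∈ Icc (0:ℝ) 1, k x = k 0 := by
  let η : ContDiffBump (1/2:ℝ) := ⟨1/8, 1/4, by norm_num, by norm_num⟩
  set e : ℝ → ℝ := η.normed volume with he
  have e1 : ContDiff ℝ (⊤ : ℕ∞) e := η.contDiff_normed
  have e2 : ∫ x, e x = 1 := η.integral_normed
  have e3 : tsupport e = Metric.closedBall (1/2:ℝ) (1/4) := η.tsupport_normed_eq
  have e4 : HasCompactSupport e := by rw [HasCompactSupport, e3]; exact isCompact_closedBall _ _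
  set c := ∫ x in Ioo (0:ℝ) 1, k x * e x with hc
  have kint : ∀ φ : ℝ → ℝ, Continuous φ → IntegrableOn (fun x => k x * φ x) (Ioo 0 1) := by
    intro φ hφ
    have : ContinuousOn (fun x => k x * φ x) (Icc 0 1) := hk.mul hφ.continuousOn
    exact this.integrableOn_Icc.mono_set Ioo_subset_Icc_self
  have key : ∀ ψ : ℝ → ℝ, ContDiff ℝ (⊤ : ℕ∞) ψ → HasCompactSupport ψ → tsupport ψ ⊆ Ioo (0:ℝ) 1 →
      ∫ x, ψ x • (k x - c) = 0 := by
    intro ψ p1 p2 p3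
    set m := ∫ x, ψ x with hm
    set θ : ℝ → ℝ := fun x => ψ x - m * e x with hθ
    have t1 : ContDiff ℝ (⊤ : ℕ∞) θ := p1.sub (contDiff_const.mul e1)
    have ip := p1.continuous.integrable_of_hasCompactSupport p2 (μ := volume)
    have ie := e1.continuous.integrable_of_hasCompactSupport e4 (μ := volume)
    have t2 : Integrable θ := ip.sub (ie.const_mul m)
    have t3 : ∫ x, θ x = 0 := by
      simp only [hθ]
      rw [integral_sub ip (ie.const_mul m), integral_const_mul, e2]; simp [hm]
    set φ : ℝ → ℝ := fun x => ∫ t in Iic x, θ t with hφ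
    have f1 : ∀ x, HasDerivAt φ (θ x) x := hlp_iic_deriv t1.continuous t2
    have f2 : deriv φ = θ := funext fun x => (f1 x).deriv
    have f3 : ContDiff ℝ (⊤ : ℕ∞) φ := by
      rw [contDiff_infty_iff_deriv]
      exact ⟨fun x => (f1 x).differentiableAt, by rw [f2]; exact t1⟩
    set K := tsupport ψ ∪ tsupport e with hK
    have K1 : IsCompact K := IsCompact.union p2 e4
    have K2 : K.Nonempty := ⟨1/2, Or.inr (by rw [e3]; simp)⟩
    have K3 : K ⊆ Ioo 0 1 := by
      refine union_subset p3 ?_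
      rw [e3, Real.closedBall_eq_Icc]
      intro x hx
      constructor <;> [linarith [hx.1]; linarith [hx.2]]
    have K4 : ∀ x ∉ K, θ x = 0 := by
      intro x hx
      simp only [hθ]
      rw [image_eq_zero_of_notMem_tsupport fun h => hx (Or.inl h),
        image_eq_zero_of_notMem_tsupport fun h => hx (Or.inr h)]; simp
    have f4 : tsupport φ ⊆ Icc (sInf K) (sSup K) := by
      apply closure_minimal _ isClosed_Icc
      intro x hx
      by_contra hcon
      apply hx
      rw [mem_Icc, not_and_or, not_le, not_le] at hcon
      rcases hcon with hcon | hcon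
      · apply setIntegral_eq_zero_of_forall_eq_zero
        intro t ht
        apply K4
        intro htK
        have := csInf_le K1.bddBelow htK
        have ht' : t ≤ x := ht
        linarith
      · simp only [hφ]
        rw [setIntegral_eq_integral_of_forall_compl_eq_zero, t3]
        intro t ht
        apply K4
        intro htK
        have := le_csSup K1.bddAbove htK
        have ht' : ¬ t ≤ x := ht
        exact ht' (by linarith)
    have f5 : tsupport φ ⊆ Ioo 0 1 := fun x hx =>
      ⟨(K3 (K1.sInf_mem K2)).1.trans_le (f4 hx).1, (f4 hx).2.trans_lt (K3 (K1.sSup_mem K2)).2⟩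
    have f6 : HasCompactSupport φ := HasCompactSupport.intro' isCompact_Icc isClosed_Icc
      (fun x hx => image_eq_zero_of_notMem_tsupport fun h => hx (f4 h))
    have r := h φ f3 f6 f5
    rw [f2] at r
    have r2 : ∫ x in Ioo (0:ℝ) 1, k x * θ x = (∫ x in Ioo (0:ℝ) 1, k x * ψ x) - m * c := by
      rw [hc, ← integral_const_mul, ← integral_sub (kint ψ p1.continuous) ((kint e e1.continuous).const_mul m)]
      congr 1; ext x; simp only [hθ]; ring
    have r3 : ∫ x, ψ x • (k x - c) = ∫ x in Ioo (0:ℝ) 1, (k x * ψ x - ψ x * c) := by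
      have e : ∫ x, ψ x • (k x - c) = ∫ x, (k x - c) * ψ x := by
        congr 1; ext x; simp [mul_comm]
      rw [e, ← setint_test (φ := ψ) (u := fun x => k x - c) p3]
      congr 1; ext x; ring
    have r4 : ∫ x in Ioo (0:ℝ) 1, ψ x = m := by
      have := setint_test (φ := ψ) (u := fun _ => 1) p3
      simpa using this
    rw [r3, integral_sub (kint ψ p1.continuous) (ip.integrableOn.mul_const c), integral_mul_const, r4]
    linarith
  have ae := isOpen_Ioo.ae_eq_zero_of_integral_contDiff_smul_eq_zero (μ := volume) (U := Ioo (0:ℝ) 1) (f := fun x => k x - c)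
    ((hk.mono Ioo_subset_Icc_self).sub continuousOn_const |>.locallyIntegrableOn measurableSet_Ioo) key
  have ae2 : k =ᵐ[volume.restrict (Icc (0:ℝ) 1)] fun _ => c := by
    rw [restrict_Ioo_eq_restrict_Icc.symm]
    rw [Filter.EventuallyEq, ae_restrict_iff' measurableSet_Ioo]
    filter_upwards [ae] with x hx hx2
    linarith [hx hx2]
  have := Measure.eqOn_Icc_of_ae_eq volume zero_ne_one ae2 hk continuousOn_const
  intro x hx
  rw [this hx, this (by simp : (0:ℝ) ∈ Icc (0:ℝ) 1)]

def AC (u : ℝ → ℝ) : Prop := ∃ h : ℝ → ℝ, Measurable h ∧ MemLp h 2 volume ∧ (∀ x ∉ Icc (0:ℝ) 1, h x = 0) ∧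
  ∀ x ∈ Icc (0:ℝ) 1, u x = u 0 + ∫ t in (0:ℝ)..x, h t

theorem AC_int {h : ℝ → ℝ} (h2 : MemLp h 2 volume) (h0 : ∀ x ∉ Icc (0:ℝ) 1, h x = 0) : Integrable h := by
  have : IntegrableOn h (Icc 0 1) := (h2.restrict (Icc 0 1)).integrable (by norm_num)
  rwa [integrableOn_iff_integrable_of_support_subset] at this
  intro x hx
  by_contra hcon
  exact hx (h0 x hcon)

theorem AC_of_weak {u v : ℝ → ℝ} (hu : ContinuousOn u (Icc 0 1)) (hw : IsWeakD1 (Ioo 0 1) u v)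
    (hv : MemLp v 2 (volume.restrict (Ioo (0:ℝ) 1))) : AC u := by
  set v' := hv.1.mk v with hv'
  have m1 : Measurable v' := hv.1.stronglyMeasurable_mk.measurable
  have m2 : v =ᵐ[volume.restrict (Ioo (0:ℝ) 1)] v' := hv.1.ae_eq_mk
  set h := (Ioo (0:ℝ) 1).indicator v' with hh
  have a1 : Measurable h := m1.indicator measurableSet_Ioo
  have a2 : MemLp h 2 volume := (memLp_indicator_iff_restrict measurableSet_Ioo).2 (hv.ae_eq m2)
  have a3 : ∀ x ∉ Icc (0:ℝ) 1, h x = 0 := fun x hx =>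
    indicator_of_notMem (fun h => hx (Ioo_subset_Icc_self h)) _
  have a4 := AC_int a2 a3
  refine ⟨h, a1, a2, a3, ?_⟩
  set w : ℝ → ℝ := fun x => ∫ t in (0:ℝ)..x, h t with hwd
  have wc : Continuous w := a4.continuous_primitive 0
  have hwac : AbsolutelyContinuousOnInterval w 0 1 :=
    (a4.intervalIntegrable (a := 0) (b := 1)).absolutelyContinuousOnInterval_intervalIntegral (by simp)
  have key := dbr (k := fun x => u x - w x) (hu.sub wc.continuousOn) ?_
  · intro x hx
    have := key x hx
    simp only [hwd, intervalIntegral.integral_same] at this ⊢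
    linarith
  · intro φ p1 p2 p3
    have p1' : ContDiff ℝ 1 φ := p1.of_le (by exact_mod_cast le_top)
    have cd : Continuous (deriv φ) := p1'.continuous_deriv (by norm_num)
    have i1 : IntegrableOn (fun x => u x * deriv φ x) (Ioo 0 1) :=
      ((hu.mul cd.continuousOn).integrableOn_Icc).mono_set Ioo_subset_Icc_self
    have i2 : IntegrableOn (fun x => w x * deriv φ x) (Ioo 0 1) :=
      ((wc.continuousOn.mul cd.continuousOn).integrableOn_Icc).mono_set Ioo_subset_Icc_self
    simp_rw [sub_mul]
    rw [integral_sub i1 i2, hw φ p1 p2 p3, ibp_ac hwac p1 p3]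
    have : ∫ x in Ioo (0:ℝ) 1, v x * φ x = ∫ x in Ioo (0:ℝ) 1, deriv w x * φ x := by
      apply setIntegral_congr_ae measurableSet_Ioo
      have m2' := (ae_restrict_iff' measurableSet_Ioo).1 m2
      filter_upwards [m2', LocallyIntegrable.ae_hasDerivAt_integral a4.locallyIntegrable] with x hx hd hx2
      rw [(hd 0).deriv, hx hx2, hh, indicator_of_mem hx2]
    rw [this]; ring

theorem AC_g {g : ℝ → ℝ} (h : MemHedge 1 g) (hc : ContinuousOn g (Icc 0 1)) : AC g := by
  obtain ⟨_, v, hv, hv2⟩ := h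
  exact AC_of_weak hc hv hv2

theorem AC_f {f : ℝ → ℝ} (h : MemHedge 2 f) (hc : ContDiffOn ℝ 1 f (Icc 0 1)) :
    AC (derivWithin f (Icc 0 1)) := by
  obtain ⟨_, v, hv, hvl, v2, hv2, hv3⟩ := h
  have c1 : ContinuousOn (derivWithin f (Icc 0 1)) (Icc 0 1) :=
    hc.continuousOn_derivWithin (uniqueDiffOn_Icc zero_lt_one) (by norm_num)
  refine AC_of_weak c1 ?_ hv3
  have fac : AbsolutelyContinuousOnInterval f 0 1 :=
    ContDiffOn.absolutelyContinuousOnInterval (by rwa [uIcc_of_le zero_le_one])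
  have dd : ∀ x ∈ Ioo (0:ℝ) 1, deriv f x = derivWithin f (Icc 0 1) x := fun x hx =>
    (derivWithin_of_mem_nhds (Icc_mem_nhds hx.1 hx.2)).symm
  have c2 : IntegrableOn (derivWithin f (Icc 0 1)) (Ioo 0 1) := c1.integrableOn_Icc.mono_set Ioo_subset_Icc_self
  have c3 : IntegrableOn v (Ioo 0 1) := hvl.integrable (by norm_num)
  have ae := isOpen_Ioo.ae_eq_zero_of_integral_contDiff_smul_eq_zero (μ := volume) (U := Ioo (0:ℝ) 1)
    (f := fun x => derivWithin f (Icc 0 1) x - v x) (c2.sub c3).locallyIntegrableOn ?_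
  · intro φ p1 p2 p3
    rw [← hv2 φ p1 p2 p3]
    apply setIntegral_congr_ae measurableSet_Ioo
    filter_upwards [ae] with x hx hx2
    rw [sub_eq_zero.1 (hx hx2)]
  · intro φ p1 p2 p3
    have e1 := hv φ p1 p2 p3
    rw [ibp_ac fac p1 p3] at e1
    have e2 : ∫ x in Ioo (0:ℝ) 1, deriv f x * φ x = ∫ x in Ioo (0:ℝ) 1, derivWithin f (Icc 0 1) x * φ x := by
      apply setIntegral_congr_fun measurableSet_Ioo
      intro x hx
      simp only [dd x hx]
    rw [e2] at e1
    have e3 : ∫ x, φ x • (derivWithin f (Icc 0 1) x - v x)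
        = ∫ x in Ioo (0:ℝ) 1, (derivWithin f (Icc 0 1) x - v x) * φ x := by
      rw [setint_test p3]; congr 1; ext x; simp [mul_comm]
    obtain ⟨M, hM⟩ := p2.exists_bound_of_continuous p1.continuous
    have im : ∀ u : ℝ → ℝ, IntegrableOn u (Ioo 0 1) → IntegrableOn (fun x => u x * φ x) (Ioo 0 1) :=
      fun u hu => hu.mul_bdd (c := M) p1.continuous.aestronglyMeasurable (Filter.Eventually.of_forall hM)
    rw [e3]
    simp_rw [sub_mul]
    rw [integral_sub (im _ c2) (im _ c3)]
    linarith

theorem AC_add {u v : ℝ → ℝ} (hu : AC u) (hv : AC v) : AC (fun x => u x + v x) := by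
  obtain ⟨h, a1, a2, a3, a4⟩ := hu
  obtain ⟨k, b1, b2, b3, b4⟩ := hv
  refine ⟨fun x => h x + k x, a1.add b1, a2.add b2, fun x hx => by beta_reduce; rw [a3 x hx, b3 x hx, add_zero], ?_⟩
  intro x hx
  beta_reduce
  rw [intervalIntegral.integral_add (AC_int a2 a3).intervalIntegrable (AC_int b2 b3).intervalIntegrable,
    a4 x hx, b4 x hx]
  ring

theorem AC_smul {u : ℝ → ℝ} (hu : AC u) (c : ℝ) : AC (fun x => c * u x) := by
  obtain ⟨h, a1, a2, a3, a4⟩ := hu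
  refine ⟨fun x => c * h x, a1.const_mul c, a2.const_mul c, fun x hx => by beta_reduce; rw [a3 x hx, mul_zero], ?_⟩
  intro x hx
  beta_reduce
  rw [intervalIntegral.integral_const_mul, a4 x hx]
  ring

theorem AC_refl {u : ℝ → ℝ} (hu : AC u) : AC (fun x => u (1 - x)) := by
  obtain ⟨h, a1, a2, a3, a4⟩ := hu
  have mp : MeasurePreserving (fun x : ℝ => 1 - x) volume volume := Measure.measurePreserving_sub_left volume 1
  refine ⟨fun x => - h (1 - x), (a1.comp (measurable_const.sub measurable_id)).neg,
    (a2.comp_measurePreserving mp).neg, fun x hx => ?_, ?_⟩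
  · beta_reduce
    rw [a3, neg_zero]
    intro h; apply hx; constructor <;> linarith [h.1, h.2]
  · intro x hx
    have i := AC_int a2 a3
    beta_reduce
    rw [intervalIntegral.integral_neg, intervalIntegral.integral_comp_sub_left (fun t => h t),
      a4 (1 - x) ⟨by linarith [hx.2], by linarith [hx.1]⟩, a4 (1 - 0) (by simp),
      ← intervalIntegral.integral_add_adjacent_intervals (b := 1 - x) (c := 1 - 0) i.intervalIntegrable i.intervalIntegrable]
    ring

theorem AC_C1 {u : ℝ → ℝ} (hu : ContDiff ℝ 1 u) : AC u := by
  have cd : Continuous (deriv u) := hu.continuous_deriv (by norm_num)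
  refine ⟨(Icc (0:ℝ) 1).indicator (deriv u), cd.measurable.indicator measurableSet_Icc, ?_,
    fun x hx => indicator_of_notMem hx _, ?_⟩
  · rw [memLp_indicator_iff_restrict measurableSet_Icc]
    obtain ⟨M, hM⟩ := isCompact_Icc.exists_bound_of_continuousOn (cd.continuousOn (s := Icc (0:ℝ) 1))
    exact MemLp.of_bound cd.aestronglyMeasurable M ((ae_restrict_iff' measurableSet_Icc).2 (Filter.Eventually.of_forall hM))
  · intro x hx
    have : ∫ t in (0:ℝ)..x, (Icc (0:ℝ) 1).indicator (deriv u) t = ∫ t in (0:ℝ)..x, deriv u t := by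
      apply intervalIntegral.integral_congr
      intro t ht
      rw [uIcc_of_le hx.1] at ht
      have ht' : t ∈ Icc (0:ℝ) 1 := ⟨ht.1, ht.2.trans hx.2⟩
      rw [indicator_of_mem ht']
    rw [this, intervalIntegral.integral_deriv_eq_sub (fun t _ => hu.differentiable (by norm_num) t)
      (cd.intervalIntegrable _ _)]
    ring

theorem dat_of_AC {v : ℝ → ℝ} (hv : AC v) (h0 : v 0 = 0) (h1 : v 1 = 0) :
    ∃ h w : ℝ → ℝ, Measurable h ∧ Integrable h ∧ MemLp h 2 volume ∧ (∀ x, w x = ∫ t in Iic x, h t) ∧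
      Continuous w ∧ (∀ x ≤ 0, w x = 0) ∧ (∀ x ≥ 1, w x = 0) ∧ ∀ x ∈ Icc (0:ℝ) 1, w x = v x := by
  obtain ⟨h, a1, a2, a3, a4⟩ := hv
  have i := AC_int a2 a3
  have e0 : ∀ x ≤ 0, ∫ t in Iic x, h t = 0 := by
    intro x hx
    have : ∫ t in Iic x, h t = ∫ t in Iic x, (0:ℝ) := by
      rw [integral_Iic_eq_integral_Iio, integral_Iic_eq_integral_Iio]
      apply setIntegral_congr_fun measurableSet_Iio
      intro t ht
      apply a3
      intro h
      have h' : t < x := ht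
      linarith [h.1]
    rw [this]; simp
  have e : ∀ x, ∫ t in Iic x, h t = ∫ t in (0:ℝ)..x, h t := by
    intro x
    rw [← intervalIntegral.integral_Iic_sub_Iic i.integrableOn i.integrableOn, e0 0 le_rfl, sub_zero]
  refine ⟨h, fun x => ∫ t in Iic x, h t, a1, i, a2, fun x => rfl, ?_, e0, ?_, ?_⟩
  · simp_rw [e]; exact i.continuous_primitive 0
  · intro x hx
    have e1 : ∫ t in Iic x, h t = ∫ t in Iic (1:ℝ), h t := by
      rw [setIntegral_eq_of_subset_of_forall_sdiff_eq_zero measurableSet_Iic (Iic_subset_Iic.2 hx)]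
      intro t ht
      apply a3
      intro h'
      exact ht.2 h'.2
    beta_reduce
    rw [e1, e]
    have := a4 1 (by simp)
    linarith
  · intro x hx
    simp only [e]
    rw [a4 x hx, h0, zero_add]

theorem hA_zero (ψ V : ℝ → ℝ) (x : ℝ) : hA ψ V x 0 = V x * ∫ s in Icc (0:ℝ) 1, ψ s := by
  unfold hA
  rw [← integral_const_mul]
  simp

theorem hA_neg {ψ V : ℝ → ℝ} (hV : ∀ x ≤ 0, V x = 0) {x y : ℝ} (hx : x ≤ 0) (hy : 0 ≤ y) : hA ψ V x y = 0 := by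
  unfold hA
  apply setIntegral_eq_zero_of_forall_eq_zero
  intro s hs
  rw [hV _ (by nlinarith [mul_nonneg hy hs.1]), zero_mul]

theorem hE_KK {Ω : Set E2} (hΩ : Bornology.IsBounded Ω) {ψ V v h : ℝ → ℝ} (hψ : Continuous ψ)
    (hm : Measurable h) (h1 : Integrable h) (h2 : MemLp h 2 volume) (hv : ∀ x, v x = ∫ t in Iic x, h t)
    (hvc : Continuous v) (hvs : HasCompactSupport v) (hV : ∀ x, HasDerivAt V (v x) x)
    (α β : E2 →L[ℝ] ℝ) (hind : ∀ d, α d = 0 → β d = 0 → d = 0) (a b : ℝ) :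
    KK Ω (fun P : E2 => hA ψ V (a + α P) (b + β P)) := by
  obtain ⟨M, hM⟩ := hvs.exists_bound_of_continuous hvc
  have hM' : ∀ x, |v x| ≤ M := hM
  have e : ∀ d, (fun P => fderiv ℝ (fun P : E2 => hA ψ V (a + α P) (b + β P)) P d) =
      fun P => hA (fun s => (α d - β d * s) * ψ s) v (a + α P) (b + β P) := fun d =>
    funext fun P => hE_fderiv hψ hV hvc hM' α β a b P d
  have hψd : ∀ (ψ : ℝ → ℝ), Continuous ψ → ∀ d, Continuous (fun s => (α d - β d * s) * ψ s) := by
    intro ψ hψ d; fun_prop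
  refine ⟨hE_contDiff hψ hV hvc hM' α β a b, fun d => ?_⟩
  rw [e d]
  refine ⟨⟨hE_L2on (hψd ψ hψ d) hvc.measurable (hvc.memLp_of_hasCompactSupport hvs) α β hind a b hΩ,
    hE_gag (hψd ψ hψ d) hvc.measurable (hvc.integrable_of_hasCompactSupport hvs)
      (hvc.memLp_of_hasCompactSupport hvs) α β hind a b Ω⟩, fun d' => ?_⟩
  refine ⟨fun P => hA (fun s => (α d' - β d' * s) * ((α d - β d * s) * ψ s)) h (a + α P) (b + β P),
    ⟨hE_L2on (hψd _ (hψd ψ hψ d) d') hm h2 α β hind a b hΩ,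
     hE_gag (hψd _ (hψd ψ hψ d) d') hm h1 h2 α β hind a b Ω⟩, ?_⟩
  intro φ p1 p2 p3
  rw [hlp_setint p3, hlp_setint (φ := fun P => fderiv ℝ φ P d') ((hlp_tsd d').trans p3)]
  exact hE_weak (hψd ψ hψ d) hm h1 α β hind a b hv hvc p1 p2 d'

theorem ψ_int0 (A B : ℝ) : ∫ s in Icc (0:ℝ) 1, (A - B * s) * (4 - 6 * s) = A := by
  rw [integral_Icc_eq_integral_Ioc, ← intervalIntegral.integral_of_le zero_le_one]
  have : ∀ s : ℝ, (A - B * s) * (4 - 6 * s) = 4 * A + (- (6 * A + 4 * B)) * s ^ 1 + 6 * B * s ^ 2 := fun s => by ring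
  simp_rw [this]
  rw [intervalIntegral.integral_add, intervalIntegral.integral_add]
  · simp only [intervalIntegral.integral_const_mul, integral_pow, intervalIntegral.integral_const]
    norm_num
    ring
  all_goals apply Continuous.intervalIntegrable; fun_prop

theorem ψ_int1 (A B : ℝ) : ∫ s in Icc (0:ℝ) 1, (A - B * s) * (6 - 12 * s) = B := by
  rw [integral_Icc_eq_integral_Ioc, ← intervalIntegral.integral_of_le zero_le_one]
  have : ∀ s : ℝ, (A - B * s) * (6 - 12 * s) = 6 * A + (- (12 * A + 6 * B)) * s ^ 1 + 12 * B * s ^ 2 := fun s => by ring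
  simp_rw [this]
  rw [intervalIntegral.integral_add, intervalIntegral.integral_add]
  · simp only [intervalIntegral.integral_const_mul, integral_pow, intervalIntegral.integral_const]
    norm_num
    ring
  all_goals apply Continuous.intervalIntegrable; fun_prop

theorem corner {Ω : Set E2} (hΩ : Bornology.IsBounded Ω) {F F' G : ℝ → ℝ}
    (hF : ∀ t ∈ Icc (0:ℝ) 1, HasDerivWithinAt F (F' t) (Icc 0 1) t) (hF' : AC F') (hG : AC G)
    (F0 : F 0 = 0) (F'0 : F' 0 = 0) (F'1 : F' 1 = 0) (G0 : G 0 = 0) (G1 : G 1 = 0)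
    (α β : E2 →L[ℝ] ℝ) (hind : ∀ d, α d = 0 → β d = 0 → d = 0) (a b : ℝ) (n : E2) (hn : β n ≠ 0) :
    ∃ Z : E2 → ℝ, KK Ω Z ∧
      (∀ P, b + β P = 0 → a + α P ∈ Icc (0:ℝ) 1 → Z P = F (a + α P) ∧ fderiv ℝ Z P n = G (a + α P)) ∧
      (∀ P, a + α P ≤ 0 → 0 ≤ b + β P → Z P = 0 ∧ fderiv ℝ Z P = 0) := by
  have cs : ∀ w : ℝ → ℝ, (∀ x ≤ 0, w x = 0) → (∀ x ≥ 1, w x = 0) → HasCompactSupport w := fun w w0 w1 =>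
    HasCompactSupport.intro' (isCompact_Icc (a := (0:ℝ)) (b := 1)) isClosed_Icc fun x hx => by
      rw [mem_Icc, not_and_or, not_le, not_le] at hx
      rcases hx with hx | hx
      · exact w0 x hx.le
      · exact w1 x hx.le
  have prim : ∀ w : ℝ → ℝ, Continuous w → (∀ x ≤ 0, w x = 0) → (∀ x ≥ 1, w x = 0) →
      ∃ V : ℝ → ℝ, (∀ x, HasDerivAt V (w x) x) ∧ ∀ x ≤ 0, V x = 0 := fun w wc w0 w1 =>
    ⟨_, hlp_iic_deriv wc (wc.integrable_of_hasCompactSupport (cs w w0 w1)), fun x hx => by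
      apply setIntegral_eq_zero_of_forall_eq_zero
      intro t ht
      exact w0 t (le_trans ht hx)⟩
  obtain ⟨h0, v0, a1, a2, a3, a4, a5, a6, a7, a8⟩ := dat_of_AC hF' F'0 F'1
  have hv1 : AC (fun x => (β n)⁻¹ * (G x + (- α n) * F' x)) := AC_smul (AC_add hG (AC_smul hF' _)) _
  obtain ⟨h1, v1, b1, b2, b3, b4, b5, b6, b7, b8⟩ := dat_of_AC hv1 (by simp [G0, F'0]) (by simp [G1, F'1])
  obtain ⟨V0, a9, a10⟩ := prim v0 a5 a6 a7
  obtain ⟨V1, b9, b10⟩ := prim v1 b5 b6 b7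
  have c0 : Continuous (fun s : ℝ => 4 - 6 * s) := by fun_prop
  have c1 : Continuous (fun s : ℝ => 6 - 12 * s) := by fun_prop
  have k0 := hE_KK hΩ c0 a1 a2 a3 a4 a5 (cs _ a6 a7) a9 α β hind a b
  have k1 := hE_KK hΩ c1 b1 b2 b3 b4 b5 (cs _ b6 b7) b9 α β hind a b
  obtain ⟨M0, hM0⟩ := (cs _ a6 a7).exists_bound_of_continuous a5
  obtain ⟨M1, hM1⟩ := (cs _ b6 b7).exists_bound_of_continuous b5
  have hFV : ∀ t ∈ Icc (0:ℝ) 1, V0 t = F t := by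
    have hd : ∀ t ∈ Icc (0:ℝ) 1, HasDerivWithinAt (fun t => V0 t - F t) 0 (Icc 0 1) t := by
      intro t ht
      have := (a9 t).hasDerivWithinAt.sub (hF t ht)
      rw [a8 t ht, sub_self] at this
      exact this
    have := constant_of_derivWithin_zero (f := fun t => V0 t - F t) (a := 0) (b := 1)
      (fun t ht => (hd t ht).differentiableWithinAt)
      (fun t ht => (hd t (Ico_subset_Icc_self ht)).derivWithin (uniqueDiffOn_Icc zero_lt_one t (Ico_subset_Icc_self ht)))
    intro t ht
    have := this t ht
    rw [a10 0 le_rfl, F0] at this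
    linarith
  have fd : ∀ P d, fderiv ℝ (fun P => hA (fun s => 4 - 6 * s) V0 (a + α P) (b + β P) +
      hA (fun s => 6 - 12 * s) V1 (a + α P) (b + β P)) P d =
      hA (fun s => (α d - β d * s) * (4 - 6 * s)) v0 (a + α P) (b + β P) +
      hA (fun s => (α d - β d * s) * (6 - 12 * s)) v1 (a + α P) (b + β P) := by
    intro P d
    rw [← hE_fderiv c0 a9 a5 hM0 α β a b P d, ← hE_fderiv c1 b9 b5 hM1 α β a b P d]
    rw [fderiv_fun_add (k0.1.differentiable (by norm_num) P) (k1.1.differentiable (by norm_num) P)]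
    rfl
  refine ⟨_, KK_add hΩ k0 k1, ?_, ?_⟩
  · intro P hb ha
    refine ⟨?_, ?_⟩
    · have e0 : ∫ s in Icc (0:ℝ) 1, (4 - 6 * s) = 1 := by simpa using ψ_int0 1 0
      have e1 : ∫ s in Icc (0:ℝ) 1, (6 - 12 * s) = 0 := by simpa using ψ_int1 1 0
      beta_reduce
      rw [hb, hA_zero, hA_zero, e0, e1, hFV _ ha]; ring
    · rw [fd, hb, hA_zero, hA_zero, ψ_int0, ψ_int1, a8 _ ha, b8 _ ha]
      field_simp
      ring
  · intro P ha hb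
    refine ⟨?_, ?_⟩
    · beta_reduce
      rw [hA_neg a10 ha hb, hA_neg b10 ha hb, add_zero]
    · ext d
      rw [fd, hA_neg a6 ha hb, hA_neg b6 ha hb]
      simp

theorem cutoff_fd {A B C : E2 → ℝ} {LA LB LC : E2 →L[ℝ] ℝ} {P : E2} (hA : HasFDerivAt A LA P)
    (hB : HasFDerivAt B LB P) (hC : HasFDerivAt C LC P) (d : E2) :
    fderiv ℝ (fun P => A P ^ 2 * (A P + 3 * B P + 3 * C P + 6 * B P * C P)) P d =
      2 * A P * LA d * (A P + 3 * B P + 3 * C P + 6 * B P * C P) +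
        A P ^ 2 * (LA d + 3 * LB d + 3 * LC d + 6 * (LB d * C P + B P * LC d)) := by
  have h := (hA.pow 2).mul (((hA.add (hB.const_mul 3)).add (hC.const_mul 3)).add ((hB.const_mul 6).mul hC))
  have h2 : HasFDerivAt (fun P => A P ^ 2 * (A P + 3 * B P + 3 * C P + 6 * B P * C P)) _ P := h
  rw [h2.fderiv]
  simp
  ring

theorem fd_mul_apply {X Z : E2 → ℝ} {P : E2} (hX : DifferentiableAt ℝ X P) (hZ : DifferentiableAt ℝ Z P) (d : E2) :
    fderiv ℝ (fun P => X P * Z P) P d = X P * fderiv ℝ Z P d + Z P * fderiv ℝ X P d := by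
  rw [fderiv_fun_mul hX hZ]
  simp

theorem edge_corr {Ω : Set E2} (hΩ : Bornology.IsBounded Ω) (hΩm : MeasurableSet Ω) {F F' G : ℝ → ℝ}
    (hF : ∀ t ∈ Icc (0:ℝ) 1, HasDerivWithinAt F (F' t) (Icc 0 1) t) (hF' : AC F') (hG : AC G)
    (F0 : F 0 = 0) (F1 : F 1 = 0) (F'0 : F' 0 = 0) (F'1 : F' 1 = 0) (G0 : G 0 = 0) (G1 : G 1 = 0)
    (LA LB LC : E2 →L[ℝ] ℝ) (a b c : ℝ) (hsum : ∀ P, (a + LA P) + (b + LB P) + (c + LC P) = 1)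
    (hind1 : ∀ d, LB d = 0 → LC d = 0 → d = 0) (hind2 : ∀ d, LA d = 0 → LC d = 0 → d = 0)
    (n : E2) (hn : LC n ≠ 0) :
    ∃ Y : E2 → ℝ, KK Ω Y ∧
      (∀ P, c + LC P = 0 → b + LB P ∈ Icc (0:ℝ) 1 → Y P = F (b + LB P) ∧ fderiv ℝ Y P n = G (b + LB P)) ∧
      (∀ P, a + LA P = 0 → 0 ≤ b + LB P → 0 ≤ c + LC P → Y P = 0 ∧ fderiv ℝ Y P = 0) ∧
      (∀ P, b + LB P = 0 → 0 ≤ a + LA P → 0 ≤ c + LC P → Y P = 0 ∧ fderiv ℝ Y P = 0) := by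
  obtain ⟨Z1, k1, z1, z1'⟩ := corner hΩ hF hF' hG F0 F'0 F'1 G0 G1 LB LC hind1 b c n hn
  have hFr : ∀ t ∈ Icc (0:ℝ) 1, HasDerivWithinAt (fun t => F (1 - t)) ((-1) * F' (1 - t)) (Icc 0 1) t := by
    intro t ht
    have m : MapsTo (fun t : ℝ => 1 - t) (Icc 0 1) (Icc 0 1) := fun s hs =>
      ⟨by linarith [hs.2], by linarith [hs.1]⟩
    have h1 : HasDerivWithinAt (fun t : ℝ => 1 - t) (-1) (Icc 0 1) t :=
      ((hasDerivAt_id t).const_sub 1).hasDerivWithinAt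
    have h2 := (hF (1 - t) (m ht)).comp t h1 m
    rw [mul_comm]
    exact h2
  obtain ⟨Z2, k2, z2, z2'⟩ := corner hΩ hFr (AC_smul (AC_refl hF') (-1)) (AC_refl hG) (by simp [F1]) (by simp [F'1])
    (by simp [F'0]) (by simp [G1]) (by simp [G0]) LA LC hind2 a c n hn
  have dA : ∀ P, HasFDerivAt (fun P => a + LA P) LA P := fun P => LA.hasFDerivAt.const_add a
  have dB : ∀ P, HasFDerivAt (fun P => b + LB P) LB P := fun P => LB.hasFDerivAt.const_add b
  have dC : ∀ P, HasFDerivAt (fun P => c + LC P) LC P := fun P => LC.hasFDerivAt.const_add c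
  have hsum' : ∀ d, LA d + LB d + LC d = 0 := by
    intro d
    have h1 := hsum d
    have h2 := hsum 0
    simp only [map_zero] at h2
    linarith
  set X1 : E2 → ℝ := fun P => (a + LA P) ^ 2 * ((a + LA P) + 3 * (b + LB P) + 3 * (c + LC P) + 6 * (b + LB P) * (c + LC P)) with hX1
  set X2 : E2 → ℝ := fun P => (b + LB P) ^ 2 * ((b + LB P) + 3 * (a + LA P) + 3 * (c + LC P) + 6 * (a + LA P) * (c + LC P)) with hX2
  have s1 : ContDiff ℝ (⊤ : ℕ∞) X1 := by
    have := LA.contDiff (n := ((⊤ : ℕ∞) : WithTop ℕ∞))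
    have := LB.contDiff (n := ((⊤ : ℕ∞) : WithTop ℕ∞))
    have := LC.contDiff (n := ((⊤ : ℕ∞) : WithTop ℕ∞))
    simp only [hX1]; fun_prop
  have s2 : ContDiff ℝ (⊤ : ℕ∞) X2 := by
    have := LA.contDiff (n := ((⊤ : ℕ∞) : WithTop ℕ∞))
    have := LB.contDiff (n := ((⊤ : ℕ∞) : WithTop ℕ∞))
    have := LC.contDiff (n := ((⊤ : ℕ∞) : WithTop ℕ∞))
    simp only [hX2]; fun_prop
  have X1d : ∀ P d, fderiv ℝ X1 P d = _ := fun P d => cutoff_fd (dA P) (dB P) (dC P) d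
  have X2d : ∀ P d, fderiv ℝ X2 P d = _ := fun P d => cutoff_fd (dB P) (dA P) (dC P) d
  have e1 : ∀ P, DifferentiableAt ℝ X1 P := fun P => s1.differentiable (by simp) P
  have e2 : ∀ P, DifferentiableAt ℝ X2 P := fun P => s2.differentiable (by simp) P
  have e3 : ∀ P, DifferentiableAt ℝ Z1 P := fun P => k1.1.differentiable (by norm_num) P
  have e4 : ∀ P, DifferentiableAt ℝ Z2 P := fun P => k2.1.differentiable (by norm_num) P
  have fd : ∀ P d, fderiv ℝ (fun P => X1 P * Z1 P + X2 P * Z2 P) P d =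
      (X1 P * fderiv ℝ Z1 P d + Z1 P * fderiv ℝ X1 P d) + (X2 P * fderiv ℝ Z2 P d + Z2 P * fderiv ℝ X2 P d) := by
    intro P d
    rw [fderiv_fun_add (f := fun P => X1 P * Z1 P) (g := fun P => X2 P * Z2 P) ((e1 P).mul (e3 P)) ((e2 P).mul (e4 P)), ← fd_mul_apply (e1 P) (e3 P), ← fd_mul_apply (e2 P) (e4 P)]
    rfl
  refine ⟨_, KK_add hΩ (KK_mul hΩ hΩm s1 k1) (KK_mul hΩ hΩm s2 k2), ?_, ?_, ?_⟩
  · intro P hc hb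
    have ha : a + LA P = 1 - (b + LB P) := by linarith [hsum P]
    have ha' : a + LA P ∈ Icc (0:ℝ) 1 := by rw [ha]; exact ⟨by linarith [hb.2], by linarith [hb.1]⟩
    obtain ⟨p1, p2⟩ := z1 P hc hb
    obtain ⟨q1, q2⟩ := z2 P hc ha'
    have r : 1 - (a + LA P) = b + LB P := by linarith
    rw [r] at q1 q2
    have x12 : X1 P + X2 P = 1 := by
      simp only [hX1, hX2]
      rw [hc, ha]; ring
    refine ⟨?_, ?_⟩
    · rw [p1, q1, ← add_mul, x12, one_mul]
    · rw [fd, p1, p2, q1, q2]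
      have : fderiv ℝ X1 P n + fderiv ℝ X2 P n = 0 := by
        rw [X1d, X2d, hc, ha]
        have : LA n = - LB n - LC n := by linarith [hsum' n]
        rw [this]; ring
      linear_combination G (b + LB P) * x12 + F (b + LB P) * this
  · intro P ha hb hc
    obtain ⟨q1, q2⟩ := z2' P ha.le hc
    have x0 : X1 P = 0 := by simp only [hX1]; rw [ha]; ring
    have x0' : ∀ d, fderiv ℝ X1 P d = 0 := fun d => by rw [X1d, ha]; ring
    refine ⟨?_, ?_⟩
    · rw [x0, q1]; ring
    · ext d
      rw [fd, x0, x0', q1, q2]; simp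
  · intro P hb ha hc
    obtain ⟨q1, q2⟩ := z1' P hb.le hc
    have x0 : X2 P = 0 := by simp only [hX2]; rw [hb]; ring
    have x0' : ∀ d, fderiv ℝ X2 P d = 0 := fun d => by rw [X2d, hb]; ring
    refine ⟨?_, ?_⟩
    · rw [x0, q1]; ring
    · ext d
      rw [fd, x0, x0', q1, q2]; simp

def DD (p : Fin 3 → E2) : ℝ := (p 1 - p 0) 0 * (p 2 - p 0) 1 - (p 1 - p 0) 1 * (p 2 - p 0) 0

def LL (p : Fin 3 → E2) (i : Fin 3) : E2 →L[ℝ] ℝ :=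
  (DD p)⁻¹ • ((evec p i 0) • EuclideanSpace.proj (𝕜 := ℝ) (1 : Fin 2) - (evec p i 1) • EuclideanSpace.proj (𝕜 := ℝ) (0 : Fin 2))

def lc (p : Fin 3 → E2) (i : Fin 3) : ℝ := - LL p i (p (i + 1))

theorem LL_apply (p : Fin 3 → E2) (i : Fin 3) (d : E2) :
    LL p i d = (DD p)⁻¹ * (evec p i 0 * d 1 - evec p i 1 * d 0) := by
  simp [LL]

theorem f3a : (1 : Fin 3) + 1 = 2 := rfl
theorem f3b : (1 : Fin 3) + 2 = 0 := rfl
theorem f3c : (2 : Fin 3) + 1 = 0 := rfl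
theorem f3d : (2 : Fin 3) + 2 = 1 := rfl

theorem LL_hind1 {p : Fin 3 → E2} (hD : DD p ≠ 0) (j : Fin 3) (d : E2) (h1 : LL p (j + 2) d = 0) (h2 : LL p j d = 0) :
    d = 0 := by
  rw [LL_apply] at h1 h2
  have h1' := (mul_eq_zero.1 h1).resolve_left (inv_ne_zero hD)
  have h2' := (mul_eq_zero.1 h2).resolve_left (inv_ne_zero hD)
  have hd0 : DD p * d 0 = 0 := by
    unfold DD
    unfold evec at h1' h2'
    fin_cases j
    · simp [f3a, f3b, f3c, f3d, -mul_eq_zero] at h1' h2' ⊢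
      linear_combination (p 2 0 - p 1 0) * h1' - (p 1 0 - p 0 0) * h2'
    · simp [f3a, f3b, f3c, f3d, -mul_eq_zero] at h1' h2' ⊢
      linear_combination (p 0 0 - p 2 0) * h1' - (p 2 0 - p 1 0) * h2'
    · simp [f3a, f3b, f3c, f3d, -mul_eq_zero] at h1' h2' ⊢
      linear_combination (p 1 0 - p 0 0) * h1' - (p 0 0 - p 2 0) * h2'
  have hd1 : DD p * d 1 = 0 := by
    unfold DD
    unfold evec at h1' h2'
    fin_cases j
    · simp [f3a, f3b, f3c, f3d, -mul_eq_zero] at h1' h2' ⊢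
      linear_combination (p 2 1 - p 1 1) * h1' - (p 1 1 - p 0 1) * h2'
    · simp [f3a, f3b, f3c, f3d, -mul_eq_zero] at h1' h2' ⊢
      linear_combination (p 0 1 - p 2 1) * h1' - (p 2 1 - p 1 1) * h2'
    · simp [f3a, f3b, f3c, f3d, -mul_eq_zero] at h1' h2' ⊢
      linear_combination (p 1 1 - p 0 1) * h1' - (p 0 1 - p 2 1) * h2'
  have k0 := (mul_eq_zero.1 hd0).resolve_left hD
  have k1 := (mul_eq_zero.1 hd1).resolve_left hD
  ext i
  fin_cases i
  · simpa using k0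
  · simpa using k1

theorem LL_sum (p : Fin 3 → E2) (j : Fin 3) (d : E2) : LL p (j + 1) d + LL p (j + 2) d + LL p j d = 0 := by
  simp only [LL_apply, evec]
  fin_cases j <;> simp [f3a, f3b, f3c, f3d] <;> ring

theorem LL_hind2 {p : Fin 3 → E2} (hD : DD p ≠ 0) (j : Fin 3) (d : E2) (h1 : LL p (j + 1) d = 0) (h2 : LL p j d = 0) :
    d = 0 := by
  refine LL_hind1 hD j d ?_ h2
  have := LL_sum p j d
  linarith

theorem lam_sum {p : Fin 3 → E2} (hD : DD p ≠ 0) (j : Fin 3) (P : E2) :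
    (lc p (j + 1) + LL p (j + 1) P) + (lc p (j + 2) + LL p (j + 2) P) + (lc p j + LL p j P) = 1 := by
  have h := LL_sum p j P
  have : lc p (j + 1) + lc p (j + 2) + lc p j = 1 := by
    simp only [lc, LL_apply]
    rw [← mul_neg, ← mul_neg, ← mul_neg, ← mul_add, ← mul_add, inv_mul_eq_iff_eq_mul₀ hD]
    unfold DD evec
    fin_cases j <;> simp [f3a, f3b, f3c, f3d] <;> ring
  linarith

theorem lam_e0 (p : Fin 3 → E2) (j : Fin 3) (t : ℝ) : lc p j + LL p j (epar p j t) = 0 := by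
  simp only [lc, LL_apply, epar]
  simp
  ring

theorem lam_e2 {p : Fin 3 → E2} (hD : DD p ≠ 0) (j : Fin 3) (t : ℝ) : lc p (j + 2) + LL p (j + 2) (epar p j t) = t := by
  simp only [lc, LL_apply, epar]
  rw [← mul_neg, ← mul_add, inv_mul_eq_iff_eq_mul₀ hD]
  unfold DD evec
  fin_cases j <;> simp [f3a, f3b, f3c, f3d] <;> ring

theorem lam_e1 {p : Fin 3 → E2} (hD : DD p ≠ 0) (j : Fin 3) (t : ℝ) : lc p (j + 1) + LL p (j + 1) (epar p j t) = 1 - t := by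
  have := lam_sum hD j (epar p j t)
  rw [lam_e0, lam_e2 hD] at this
  linarith

theorem evec_ne {p : Fin 3 → E2} (hD : DD p ≠ 0) (j : Fin 3) : evec p j ≠ 0 := by
  intro h
  have h1 := lam_e2 hD j 1
  have h0 := lam_e2 hD j 0
  unfold epar at h1 h0
  rw [h] at h1 h0
  simp at h1 h0
  linarith

theorem LL_nor {p : Fin 3 → E2} (hD : DD p ≠ 0) (j : Fin 3) : LL p j (norv p j) ≠ 0 := by
  have he := evec_ne hD j
  have hl : elen p j ≠ 0 := norm_ne_zero_iff.2 he
  have hs : elen p j ^ 2 = evec p j 0 ^ 2 + evec p j 1 ^ 2 := by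
    unfold elen
    rw [EuclideanSpace.norm_sq_eq]
    simp
  have : LL p j (norv p j) = - (DD p)⁻¹ * elen p j := by
    rw [LL_apply]
    have : elen p j = (elen p j)⁻¹ * (evec p j 0 ^ 2 + evec p j 1 ^ 2) := by
      rw [← hs]; field_simp
    rw [this]
    simp [norv, tangv]
    ring
  rw [this]
  exact mul_ne_zero (neg_ne_zero.2 (inv_ne_zero hD)) hl

theorem epar_tau (p : Fin 3 → E2) {i j : Fin 3} (h : j ≠ i) : epar p j (tau i j) = p i := by
  unfold epar tau evec
  split_ifs with h1
  · simp [h1]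
  · have : i = j + 2 := by revert i j; decide
    simp [this]

theorem f3e (i : Fin 3) : i + 1 + 2 = i := by revert i; decide
theorem f3f (i : Fin 3) : i + 2 + 1 = i := by revert i; decide
theorem f3g (i : Fin 3) : i + 1 + 1 = i + 2 := by revert i; decide
theorem f3h (i : Fin 3) : i + 2 + 2 = i + 1 := by revert i; decide

theorem f3i (i k : Fin 3) (h : k ≠ i) : k = i + 1 ∨ k = i + 2 := by revert i k; decide
theorem f3j (i : Fin 3) : i + 1 ≠ i := by revert i; decide

theorem lam_v {p : Fin 3 → E2} (hD : DD p ≠ 0) (i : Fin 3) :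
    lc p i + LL p i (p i) = 1 ∧ ∀ k, k ≠ i → lc p k + LL p k (p i) = 0 := by
  have e : epar p (i + 2) 0 = p i := by simp [epar, f3f]
  have h0 := lam_e0 p (i + 2) 0
  have h1 := lam_e1 hD (i + 2) 0
  have h2 := lam_e2 hD (i + 2) 0
  rw [e] at h0 h1 h2
  rw [f3f] at h1
  rw [f3h] at h2
  refine ⟨by rw [h1]; ring, fun k hk => ?_⟩
  have := f3i i k hk
  rcases this with rfl | rfl
  · exact h2
  · exact h0

theorem vertex_fn {p : Fin 3 → E2} (hD : DD p ≠ 0) (c : Fin 3 → ℝ) (w : Fin 3 → E2) :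
    ∃ S : E2 → ℝ, ContDiff ℝ (⊤ : ℕ∞) S ∧ ∀ i, S (p i) = c i ∧ ∀ d, fderiv ℝ S (p i) d = ⟪w i, d⟫ := by
  set T : Fin 3 → E2 → ℝ := fun k P => ((lc p k + LL p k P) ^ 2 * (3 + (-2) * (lc p k + LL p k P))) *
    (c k + (innerSL ℝ (w k)) (P - p k)) with hT
  have hfd : ∀ k P d, HasFDerivAt (T k) (fderiv ℝ (T k) P) P ∧ fderiv ℝ (T k) P d =
      (6 * (lc p k + LL p k P) * (1 - (lc p k + LL p k P)) * LL p k d) * (c k + ⟪w k, P - p k⟫) +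
      (lc p k + LL p k P) ^ 2 * (3 + (-2) * (lc p k + LL p k P)) * ⟪w k, d⟫ := by
    intro k P d
    have h1 : HasFDerivAt (fun P => lc p k + LL p k P) (LL p k) P := (LL p k).hasFDerivAt.const_add _
    have h2 : HasFDerivAt (fun P => c k + (innerSL ℝ (w k)) (P - p k)) (innerSL ℝ (w k)) P := by
      have := ((innerSL ℝ (w k)).hasFDerivAt (x := P - p k)).comp P ((hasFDerivAt_id P).sub_const (p k))
      exact (this.congr_fderiv (by ext; simp)).const_add _
    have h3 := ((h1.pow 2).mul ((h1.const_mul (-2)).const_add 3)).mul h2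
    have h4 : HasFDerivAt (T k) _ P := h3
    refine ⟨h4.differentiableAt.hasFDerivAt, ?_⟩
    rw [h4.fderiv]
    simp
    ring
  refine ⟨fun P => ∑ k, T k P, ?_, ?_⟩
  · apply ContDiff.sum
    intro k _
    have := (LL p k).contDiff (n := ((⊤ : ℕ∞) : WithTop ℕ∞))
    have := (innerSL ℝ (w k)).contDiff (n := ((⊤ : ℕ∞) : WithTop ℕ∞))
    simp only [hT]
    fun_prop
  · intro i
    obtain ⟨l1, l0⟩ := lam_v hD i
    refine ⟨?_, fun d => ?_⟩
    · beta_reduce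
      rw [Finset.sum_eq_single i]
      · simp only [hT]; rw [l1]; simp; ring
      · intro k _ hk
        simp only [hT]; rw [l0 k hk]; ring
      · simp
    · rw [fderiv_fun_sum (fun k _ => (hfd k (p i) d).1.differentiableAt), sum_apply,
        Finset.sum_eq_single i]
      · rw [(hfd i (p i) d).2, l1]; ring
      · intro k _ hk
        rw [(hfd k (p i) d).2, l0 k hk]; ring
      · simp

theorem KK_sum {Ω : Set E2} (hΩ : Bornology.IsBounded Ω) {Y : Fin 3 → E2 → ℝ} (hY : ∀ j, KK Ω (Y j)) :
    KK Ω (fun P => ∑ j, Y j P) := by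
  simp_rw [Fin.sum_univ_three]
  exact KK_add hΩ (KK_add hΩ (hY 0) (hY 1)) (hY 2)

theorem evec_tang {p : Fin 3 → E2} (hD : DD p ≠ 0) (j : Fin 3) : evec p j = elen p j • tangv p j := by
  have hl : elen p j ≠ 0 := norm_ne_zero_iff.2 (evec_ne hD j)
  rw [tangv, smul_smul, mul_inv_cancel₀ hl, one_smul]

theorem tau_mem (i j : Fin 3) : tau i j ∈ Icc (0:ℝ) 1 := by
  unfold tau; split_ifs <;> simp

theorem epar_deriv (p : Fin 3 → E2) {ζ : E2 → ℝ} (hζ : ContDiff ℝ 1 ζ) (j : Fin 3) (t : ℝ) :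
    HasDerivAt (fun t => ζ (epar p j t)) (fderiv ℝ ζ (epar p j t) (evec p j)) t := by
  have h1 : HasDerivAt (fun t => epar p j t) (evec p j) t := by
    have := ((hasDerivAt_id t).smul_const (evec p j)).const_add (p (j + 1))
    simpa [epar] using this
  exact ((hζ.differentiable (by norm_num) (epar p j t)).hasFDerivAt).comp_hasDerivAt t h1

theorem necess {p : Fin 3 → E2} (hD : DD p ≠ 0) {f g : Fin 3 → ℝ → ℝ} {ζ : E2 → ℝ} (hζ : ContDiff ℝ 1 ζ)
    (h : TraceEq p ζ f g) : Compat p f g := by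
  refine ⟨fun i j k hj hk => ?_, fun i => (InnerProductSpace.toDual ℝ E2).symm (fderiv ℝ ζ (p i)), fun i j hj => ⟨?_, ?_⟩⟩
  · rw [← (h j _ (tau_mem i j)).1, ← (h k _ (tau_mem i k)).1, epar_tau p hj, epar_tau p hk]
  · have hd := (epar_deriv p hζ j (tau i j)).hasDerivWithinAt (s := Icc 0 1)
    have hd2 := hd.congr (f₁ := f j) (fun t ht => ((h j t ht).1).symm) ((h j _ (tau_mem i j)).1).symm
    rw [hd2.derivWithin (uniqueDiffOn_Icc zero_lt_one _ (tau_mem i j)), epar_tau p hj, InnerProductSpace.toDual_symm_apply]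
    conv_lhs => rw [evec_tang hD j]
    simp
  · rw [InnerProductSpace.toDual_symm_apply, ← (h j _ (tau_mem i j)).2, epar_tau p hj]

theorem suffic {p : Fin 3 → E2} (hD : DD p ≠ 0) {f g : Fin 3 → ℝ → ℝ} (hfg : MemBdryH2H1 f g) (hc : Compat p f g) :
    ∃ ζ : E2 → ℝ, ContDiff ℝ 1 ζ ∧ MemH52 (tri p) ζ ∧ TraceEq p ζ f g := by
  have hΩ : Bornology.IsBounded (tri p) :=
    (isBounded_convexHull.2 (finite_range p).isBounded).subset interior_subset
  have hΩm : MeasurableSet (tri p) := isOpen_interior.measurableSet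
  obtain ⟨hv, w, hw⟩ := hc
  obtain ⟨S, S1, S2⟩ := vertex_fn hD (fun i => f (i + 1) (tau i (i + 1))) w
  have S1' : ContDiff ℝ 1 S := S1.of_le (by exact_mod_cast le_top)
  have cep : ∀ j, ContDiff ℝ (⊤ : ℕ∞) (fun t => epar p j t) := by
    intro j; unfold epar; fun_prop
  have Sd : ∀ j d, ContDiff ℝ 1 (fun t => fderiv ℝ S (epar p j t) d) := by
    intro j d
    have h1 : ContDiff ℝ (⊤ : ℕ∞) (fun P => fderiv ℝ S P d) :=
      (S1.fderiv_right (m := ((⊤ : ℕ∞) : WithTop ℕ∞)) (by simp)).clm_apply contDiff_const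
    exact (h1.comp (cep j)).of_le (by exact_mod_cast le_top)
  have vert : ∀ i j, j ≠ i → f j (tau i j) + (-1) * S (epar p j (tau i j)) = 0 ∧
      derivWithin (f j) (Icc 0 1) (tau i j) + (-1) * fderiv ℝ S (epar p j (tau i j)) (evec p j) = 0 ∧
      g j (tau i j) + (-1) * fderiv ℝ S (epar p j (tau i j)) (norv p j) = 0 := by
    intro i j hj
    obtain ⟨s1, s2⟩ := S2 i
    obtain ⟨w1, w2⟩ := hw i j hj
    rw [epar_tau p hj, s1, s2, s2, w1, w2]
    refine ⟨?_, ?_, by ring⟩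
    · rw [hv i j (i + 1) hj (f3j i)]; ring
    · rw [evec_tang hD j, inner_smul_right]; ring
  have t0 : ∀ j : Fin 3, tau (j + 1) j = 0 := fun j => by simp [tau]
  have t1 : ∀ j : Fin 3, tau (j + 2) j = 1 := fun j => by
    have : j + 2 ≠ j + 1 := by revert j; decide
    simp [tau, this]
  have v0 := fun j => vert (j + 1) j (by revert j; decide)
  have v1 := fun j => vert (j + 2) j (by revert j; decide)
  simp only [t0] at v0
  simp only [t1] at v1
  have hY : ∀ j, ∃ Y : E2 → ℝ, KK (tri p) Y ∧ _ := fun j =>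
    edge_corr hΩ hΩm (F := fun t => f j t + (-1) * S (epar p j t))
      (F' := fun t => derivWithin (f j) (Icc 0 1) t + (-1) * fderiv ℝ S (epar p j t) (evec p j))
      (G := fun t => g j t + (-1) * fderiv ℝ S (epar p j t) (norv p j))
      (fun t ht => (((hfg j).2.1.differentiableOn (by norm_num) t ht).hasDerivWithinAt).add
        ((epar_deriv p S1' j t).const_mul (-1)).hasDerivWithinAt)
      (AC_add (AC_f (hfg j).1 (hfg j).2.1) (AC_smul (AC_C1 (Sd j _)) _))
      (AC_add (AC_g (hfg j).2.2.1 (hfg j).2.2.2) (AC_smul (AC_C1 (Sd j _)) _))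
      (v0 j).1 (v1 j).1 (v0 j).2.1 (v1 j).2.1 (v0 j).2.2 (v1 j).2.2
      (LL p (j + 1)) (LL p (j + 2)) (LL p j) (lc p (j + 1)) (lc p (j + 2)) (lc p j)
      (lam_sum hD j) (LL_hind1 hD j) (LL_hind2 hD j) (norv p j) (LL_nor hD j)
  choose Y y1 y2 y3 y4 using hY
  have kk := KK_add hΩ (KK_smooth hΩ hΩm S1) (KK_sum hΩ y1)
  refine ⟨_, kk.1, KK_H52 hΩ kk, ?_⟩
  intro i t ht
  have oth : ∀ j, j ≠ i → Y j (epar p i t) = 0 ∧ fderiv ℝ (Y j) (epar p i t) = 0 := by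
    intro j hj
    have l0 := lam_e0 p i t
    have l1 := lam_e1 hD i t
    have l2 := lam_e2 hD i t
    have := f3i i j hj
    rcases this with rfl | rfl
    · apply y4
      · rw [f3e]; exact l0
      · rw [f3g, l2]; exact ht.1
      · rw [l1]; linarith [ht.2]
    · apply y3
      · rw [f3f]; exact l0
      · rw [f3h, l1]; linarith [ht.2]
      · rw [l2]; exact ht.1
  have own := y2 i (epar p i t) (lam_e0 p i t) (by rw [lam_e2 hD]; exact ht)
  rw [lam_e2 hD] at own
  obtain ⟨o1, o2⟩ := own
  refine ⟨?_, ?_⟩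
  · beta_reduce
    rw [Finset.sum_eq_single i (fun j _ hj => (oth j hj).1) (by simp), o1]
    ring
  · rw [fderiv_fun_add (S1'.differentiable (by norm_num) _) ((KK_sum hΩ y1).1.differentiable (by norm_num) _),
      fderiv_fun_sum (fun j _ => (y1 j).1.differentiable (by norm_num) _),
      Finset.sum_eq_single i (fun j _ hj => (oth j hj).2) (by simp), add_apply, o2]
    ring

theorem trace_image_characterization
    (p : Fin 3 → E2) (hp : ccw p) (f g : Fin 3 → ℝ → ℝ) (hfg : MemBdryH2H1 f g) :
    Compat p f g ↔
      ∃ ζ : E2 → ℝ, ContDiff ℝ 1 ζ ∧ MemH52 (tri p) ζ ∧ TraceEq p ζ f g := by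
  have hD : DD p ≠ 0 := ne_of_gt hp
  exact ⟨fun h => suffic hD hfg h, fun ⟨ζ, h1, _, h3⟩ => necess hD h1 h3⟩
end
end

section
/- Let T and T̃ be triangles and Φ an orientation-preserving affine transformation mapping T̃ onto T (mapping vertex p̃_i to p_i and edge ẽ_i to e_i). Define Φ*(f,g) = (f̃,g̃) by f̃ = f∘Φ and g̃ = J_Φᵗ(𝔤∘Φ)·ñ_i on ẽ_i (i = 1,2,3), where J_Φ is the (constant) Jacobian matrix of Φ, ñ_i is the outward unit normal on ẽ_i, and the vector field 𝔤 on ∂T is given by 𝔤 = (∂f_i/∂t_i)t_i + g_i n_i on e_i. Then Φ* is a linear bijection from (H^2×H^1)(∂T) onto (H^2×H^1)(∂T̃), and Tr(ζ∘Φ) = Φ*(Tr ζ) for every ζ ∈ H^{5/2}(T). -/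
open MeasureTheory Real Set
open scoped RealInnerProductSpace
noncomputable section

/-- the vector field 𝔤 (2.11) on edge `i`, at parameter `t` -/
def gfield (p : Fin 3 → E2) (f g : Fin 3 → ℝ → ℝ) (i : Fin 3) (t : ℝ) : E2 :=
  ((elen p i)⁻¹ * derivWithin (f i) (Icc 0 1) t) • tangv p i + g i t • norv p i

/-- the `g`-component of the pullback `Φ*(f,g)`; here `A` is the linear part of `Φ`,
`p` the vertices of `T` and `q` the vertices of `T̃` -/
def pullG (p q : Fin 3 → E2) (A : E2 →L[ℝ] E2) (f g : Fin 3 → ℝ → ℝ) (i : Fin 3) (t : ℝ) : ℝ :=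
  ⟪ContinuousLinearMap.adjoint A (gfield p f g i t), norv q i⟫

/-! ### Elementary geometry of the edges -/

lemma inner2 (x y : E2) : ⟪x, y⟫ = x 0 * y 0 + x 1 * y 1 := by
  simp [PiLp.inner_apply, Fin.sum_univ_two, mul_comm]

lemma evec_ne_s1 {p : Fin 3 → E2} (hp : ccw p) (i : Fin 3) : evec p i ≠ 0 := by
  intro h
  have h0 : (evec p i) 0 = 0 := by rw [h]; rfl
  have h1 : (evec p i) 1 = 0 := by rw [h]; rfl
  unfold ccw at hp
  fin_cases i <;> simp [evec] at h0 h1 hp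
  · have a : p 2 0 = p 1 0 := by linarith
    have b : p 2 1 = p 1 1 := by linarith
    rw [a, b] at hp; linarith
  · have a : p 0 0 = p 2 0 := by linarith
    have b : p 0 1 = p 2 1 := by linarith
    rw [a, b] at hp; linarith
  · have a : p 1 0 = p 0 0 := by linarith
    have b : p 1 1 = p 0 1 := by linarith
    rw [a, b] at hp; linarith

lemma elen_ne {p : Fin 3 → E2} (hp : ccw p) (i : Fin 3) : elen p i ≠ 0 :=
  norm_ne_zero_iff.2 (evec_ne_s1 hp i)

lemma norv_zero (p : Fin 3 → E2) (i : Fin 3) : norv p i 0 = tangv p i 1 := by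
  simp [norv]

lemma norv_one (p : Fin 3 → E2) (i : Fin 3) : norv p i 1 = -(tangv p i 0) := by
  simp [norv]

lemma tang_unit {p : Fin 3 → E2} (hp : ccw p) (i : Fin 3) :
    tangv p i 0 * tangv p i 0 + tangv p i 1 * tangv p i 1 = 1 := by
  rw [← inner2, real_inner_self_eq_norm_sq, tangv, norm_smul, norm_inv]
  have := elen_ne hp i
  have h : ‖elen p i‖ = ‖evec p i‖ := by simp [elen]
  rw [h, inv_mul_cancel₀ (by simpa [elen] using this)]; norm_num

lemma expand {p : Fin 3 → E2} (hp : ccw p) (i : Fin 3) (w : E2) :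
    ⟪w, tangv p i⟫ • tangv p i + ⟪w, norv p i⟫ • norv p i = w := by
  have h := tang_unit hp i
  ext k
  rw [inner2, inner2, norv_zero, norv_one]
  fin_cases k
  · simp [norv_zero]; linear_combination (w 0) * h
  · simp [norv_one]; linear_combination (w 1) * h

lemma inner_comb_n {p : Fin 3 → E2} (hp : ccw p) (i : Fin 3) (a c : ℝ) :
    ⟪a • tangv p i + c • norv p i, norv p i⟫ = c := by
  have h := tang_unit hp i
  rw [inner2, norv_zero, norv_one]
  simp [norv_zero, norv_one]
  linear_combination c * h

lemma inner_comb_t {p : Fin 3 → E2} (hp : ccw p) (i : Fin 3) (a c : ℝ) :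
    ⟪a • tangv p i + c • norv p i, tangv p i⟫ = a := by
  have h := tang_unit hp i
  rw [inner2]
  simp [norv_zero, norv_one]
  linear_combination a * h

lemma evec_eq {p : Fin 3 → E2} (hp : ccw p) (i : Fin 3) :
    evec p i = elen p i • tangv p i := by
  rw [tangv, smul_smul, mul_inv_cancel₀ (elen_ne hp i), one_smul]

/-- A vector is the value of the field as soon as its components match. -/
lemma gfield_eq {p : Fin 3 → E2} (hp : ccw p) (f g : Fin 3 → ℝ → ℝ) (i : Fin 3) (t : ℝ) (w : E2)
    (h1 : derivWithin (f i) (Icc 0 1) t = ⟪w, evec p i⟫) (h2 : g i t = ⟪w, norv p i⟫) :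
    gfield p f g i t = w := by
  rw [gfield, h1, h2, evec_eq hp, inner_smul_right, inv_mul_cancel_left₀ (elen_ne hp i)]
  exact expand hp i w

lemma gfield_evec {p : Fin 3 → E2} (hp : ccw p) (f g : Fin 3 → ℝ → ℝ) (i : Fin 3) (t : ℝ) :
    ⟪gfield p f g i t, evec p i⟫ = derivWithin (f i) (Icc 0 1) t := by
  rw [gfield, evec_eq hp, inner_smul_right, inner_comb_t hp, mul_inv_cancel_left₀ (elen_ne hp i)]

lemma gfield_pull {p q : Fin 3 → E2} (hp : ccw p) (hq : ccw q) (A : E2 →L[ℝ] E2)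
    (hA : ∀ i, A (evec q i) = evec p i) (f g : Fin 3 → ℝ → ℝ) (i : Fin 3) (t : ℝ) :
    gfield q f (pullG p q A f g) i t = ContinuousLinearMap.adjoint A (gfield p f g i t) := by
  apply gfield_eq hq
  · rw [ContinuousLinearMap.adjoint_inner_left, hA, gfield_evec hp]
  · rfl

lemma pull_pull {p q : Fin 3 → E2} (hp : ccw p) (hq : ccw q) (A B : E2 →L[ℝ] E2)
    (hA : ∀ i, A (evec q i) = evec p i) (hAB : ∀ x, A (B x) = x) (f g : Fin 3 → ℝ → ℝ) :
    pullG q p B f (pullG p q A f g) = g := by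
  funext i t
  rw [pullG, gfield_pull hp hq A hA, ContinuousLinearMap.adjoint_inner_left,
    ContinuousLinearMap.adjoint_inner_left, hAB, gfield, inner_comb_n hp]

lemma compat_pull {p q : Fin 3 → E2} (hp : ccw p) (hq : ccw q) (A : E2 →L[ℝ] E2)
    (hA : ∀ i, A (evec q i) = evec p i) (f g : Fin 3 → ℝ → ℝ) (h : Compat p f g) :
    Compat q f (pullG p q A f g) := by
  obtain ⟨h1, w, hw⟩ := h
  refine ⟨h1, fun i => ContinuousLinearMap.adjoint A (w i), fun i j hij => ?_⟩
  obtain ⟨ha, hb⟩ := hw i j hij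
  rw [← inner_smul_right, ← evec_eq hp] at ha
  constructor
  · rw [← inner_smul_right, ← evec_eq hq, ContinuousLinearMap.adjoint_inner_left, hA, ha]
  · rw [pullG, gfield_eq hp f g j _ (w i) ha hb]

/-! ### Sobolev regularity on the edges -/

lemma memLp_of_cont {u : ℝ → ℝ} (hu : ContinuousOn u (Icc 0 1)) :
    MemLp u 2 (volume.restrict (Ioo (0:ℝ) 1)) := by
  obtain ⟨C, hC⟩ := isCompact_Icc.exists_bound_of_continuousOn hu
  have hm : AEStronglyMeasurable u (volume.restrict (Ioo (0:ℝ) 1)) :=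
    (hu.mono Ioo_subset_Icc_self).aestronglyMeasurable measurableSet_Ioo
  refine MemLp.of_bound hm C ?_
  filter_upwards [ae_restrict_mem measurableSet_Ioo] with x hx
  exact hC x (Ioo_subset_Icc_self hx)

lemma integ_mul {u φ : ℝ → ℝ} (hu : MemLp u 2 (volume.restrict (Ioo (0:ℝ) 1)))
    (hφ : Continuous φ) : IntegrableOn (fun t => u t * φ t) (Ioo (0:ℝ) 1) :=
  hu.integrable_mul (memLp_of_cont hφ.continuousOn)

lemma weak_comb {u₁ v₁ u₂ v₂ : ℝ → ℝ} (a c : ℝ)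
    (hu₁ : MemLp u₁ 2 (volume.restrict (Ioo (0:ℝ) 1)))
    (hv₁ : MemLp v₁ 2 (volume.restrict (Ioo (0:ℝ) 1)))
    (hu₂ : MemLp u₂ 2 (volume.restrict (Ioo (0:ℝ) 1)))
    (hv₂ : MemLp v₂ 2 (volume.restrict (Ioo (0:ℝ) 1)))
    (h₁ : IsWeakD1 (Ioo 0 1) u₁ v₁) (h₂ : IsWeakD1 (Ioo 0 1) u₂ v₂) :
    IsWeakD1 (Ioo 0 1) (fun t => a * u₁ t + c * u₂ t) (fun t => a * v₁ t + c * v₂ t) := by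
  intro φ hφ hc hs
  have e1 := h₁ φ hφ hc hs
  have e2 := h₂ φ hφ hc hs
  have hd : Continuous (deriv φ) := hφ.continuous_deriv (by norm_cast)
  have i1 := (integ_mul hu₁ hd).const_mul a
  have i2 := (integ_mul hu₂ hd).const_mul c
  have i3 := (integ_mul hv₁ hφ.continuous).const_mul a
  have i4 := (integ_mul hv₂ hφ.continuous).const_mul c
  have l : ∫ t in Ioo (0:ℝ) 1, (a * u₁ t + c * u₂ t) * deriv φ t
      = a * (∫ t in Ioo (0:ℝ) 1, u₁ t * deriv φ t) + c * ∫ t in Ioo (0:ℝ) 1, u₂ t * deriv φ t := by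
    rw [← integral_const_mul, ← integral_const_mul, ← integral_add i1 i2]
    congr 1; funext t; ring
  have r : ∫ t in Ioo (0:ℝ) 1, (a * v₁ t + c * v₂ t) * φ t
      = a * (∫ t in Ioo (0:ℝ) 1, v₁ t * φ t) + c * ∫ t in Ioo (0:ℝ) 1, v₂ t * φ t := by
    rw [← integral_const_mul, ← integral_const_mul, ← integral_add i3 i4]
    congr 1; funext t; ring
  rw [l, r, e1, e2]; ring

lemma memH1_comb {u₁ u₂ : ℝ → ℝ} (a c : ℝ) (h₁ : MemHedge 1 u₁) (h₂ : MemHedge 1 u₂) :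
    MemHedge 1 (fun t => a * u₁ t + c * u₂ t) := by
  obtain ⟨hu₁, v₁, w₁, hv₁⟩ := h₁
  obtain ⟨hu₂, v₂, w₂, hv₂⟩ := h₂
  exact ⟨(hu₁.const_mul a).add (hu₂.const_mul c), _, weak_comb a c hu₁ hv₁ hu₂ hv₂ w₁ w₂,
    (MemLp.const_mul hv₁ a).add (MemLp.const_mul hv₂ c)⟩

lemma cont_dw {f : ℝ → ℝ} (hf : ContDiffOn ℝ 1 f (Icc 0 1)) :
    ContinuousOn (derivWithin f (Icc 0 1)) (Icc 0 1) :=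
  hf.continuousOn_derivWithin (uniqueDiffOn_Icc zero_lt_one) le_rfl

lemma parts {f φ : ℝ → ℝ} (hf : ContDiffOn ℝ 1 f (Icc 0 1)) (hφ : ContDiff ℝ (⊤ : ℕ∞) φ)
    (hs : tsupport φ ⊆ Ioo 0 1) :
    ∫ t in Ioo (0:ℝ) 1, f t * deriv φ t
      = - ∫ t in Ioo (0:ℝ) 1, derivWithin f (Icc 0 1) t * φ t := by
  have hd : Continuous (deriv φ) := hφ.continuous_deriv (by norm_cast)
  have z : ∀ x, x ∉ Ioo (0:ℝ) 1 → φ x = 0 := fun x hx =>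
    image_eq_zero_of_notMem_tsupport (fun h => hx (hs h))
  have key := intervalIntegral.integral_mul_deriv_eq_deriv_mul_of_hasDerivAt
    (a := (0:ℝ)) (b := 1) (u := f) (v := φ) (u' := derivWithin f (Icc 0 1)) (v' := deriv φ)
    (by rw [uIcc_of_le zero_le_one]; exact hf.continuousOn) hφ.continuous.continuousOn
    (by
      intro x hx
      rw [min_eq_left zero_le_one, max_eq_right zero_le_one] at hx
      have hn : Icc (0:ℝ) 1 ∈ nhds x := Icc_mem_nhds hx.1 hx.2
      have := (hf.differentiableOn one_ne_zero x (Ioo_subset_Icc_self hx)).hasDerivWithinAt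
      exact this.hasDerivAt hn)
    (fun x _ => (hφ.differentiable (by simp) x).hasDerivAt)
    (by
      apply ContinuousOn.intervalIntegrable
      rw [uIcc_of_le zero_le_one]; exact cont_dw hf)
    (hd.intervalIntegrable _ _)
  rw [z 0 (by simp), z 1 (by simp), intervalIntegral.integral_of_le zero_le_one,
    intervalIntegral.integral_of_le zero_le_one, integral_Ioc_eq_integral_Ioo,
    integral_Ioc_eq_integral_Ioo] at key
  rw [key]; ring

lemma memH1_dw {f : ℝ → ℝ} (hf : ContDiffOn ℝ 1 f (Icc 0 1)) (h : MemHedge 2 f) :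
    MemHedge 1 (derivWithin f (Icc 0 1)) := by
  obtain ⟨_, v, hv, hv2, w, hw, hwm⟩ := h
  refine ⟨memLp_of_cont (cont_dw hf), w, ?_, hwm⟩
  intro φ hφ hc hs
  have hφ' : ContDiff ℝ (⊤ : ℕ∞) (deriv φ) := (contDiff_infty_iff_deriv.1 hφ).2
  have hs' : tsupport (deriv φ) ⊆ Ioo 0 1 := tsupport_deriv_subset.trans hs
  have a := parts hf hφ' hs'
  have b := hv (deriv φ) hφ' hc.deriv hs'
  have c := hw φ hφ hc hs
  linarith

lemma pullG_formula (p q : Fin 3 → E2) (A : E2 →L[ℝ] E2) (f g : Fin 3 → ℝ → ℝ) (i : Fin 3) :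
    pullG p q A f g i = fun t =>
      ((elen p i)⁻¹ * ⟪tangv p i, A (norv q i)⟫) * derivWithin (f i) (Icc 0 1) t
        + ⟪norv p i, A (norv q i)⟫ * g i t := by
  funext t
  rw [pullG, ContinuousLinearMap.adjoint_inner_left, gfield, inner_add_left,
    real_inner_smul_left, real_inner_smul_left]
  ring

lemma mem_pull (p q : Fin 3 → E2) (A : E2 →L[ℝ] E2) (f g : Fin 3 → ℝ → ℝ)
    (h : MemBdryH2H1 f g) : MemBdryH2H1 f (pullG p q A f g) := by
  intro i
  obtain ⟨h1, h2, h3, h4⟩ := h i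
  rw [pullG_formula]
  exact ⟨h1, h2, memH1_comb _ _ (memH1_dw h2 h1) h3,
    (continuousOn_const.mul (cont_dw h2)).add (continuousOn_const.mul h4)⟩

theorem pullback_bijection_and_trace
    (p q : Fin 3 → E2) (hp : ccw p) (hq : ccw q)
    (A : E2 →L[ℝ] E2) (b : E2)
    (hdet : 0 < LinearMap.det (A : E2 →ₗ[ℝ] E2))
    (hmap : ∀ i, A (q i) + b = p i) :
    -- Φ* maps (H²×H¹)(∂T) into (H²×H¹)(∂T̃), and conversely
    (∀ f g : Fin 3 → ℝ → ℝ,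
      (MemBdryH2H1 f g ∧ Compat p f g) ↔ (MemBdryH2H1 f (pullG p q A f g) ∧ Compat q f (pullG p q A f g))) ∧
    -- Φ* is injective on (H²×H¹)(∂T)
    (∀ f g f' g', MemBdryH2H1 f g → Compat p f g → MemBdryH2H1 f' g' → Compat p f' g' →
      f = f' → pullG p q A f g = pullG p q A f' g' → g = g') ∧
    -- Φ* is surjective onto (H²×H¹)(∂T̃)
    (∀ ft gt, MemBdryH2H1 ft gt → Compat q ft gt →
      ∃ f g, MemBdryH2H1 f g ∧ Compat p f g ∧ f = ft ∧ pullG p q A f g = gt) ∧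
    -- Φ* is linear
    (∀ (a : ℝ) f₁ g₁ f₂ g₂, MemBdryH2H1 f₁ g₁ → Compat p f₁ g₁ → MemBdryH2H1 f₂ g₂ → Compat p f₂ g₂ →
      ∀ i, ∀ t ∈ Icc (0:ℝ) 1,
        pullG p q A (fun j s => a * f₁ j s + f₂ j s) (fun j s => a * g₁ j s + g₂ j s) i t
          = a * pullG p q A f₁ g₁ i t + pullG p q A f₂ g₂ i t) ∧
    -- Tr (ζ ∘ Φ) = Φ* (Tr ζ) for every ζ ∈ H^{5/2}(T)
    (∀ (ζ : E2 → ℝ) (f g : Fin 3 → ℝ → ℝ), ContDiff ℝ 1 ζ → MemH52 (tri p) ζ →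
      MemBdryH2H1 f g → Compat p f g → TraceEq p ζ f g →
      TraceEq q (fun x => ζ (A x + b)) f (pullG p q A f g)) := by
  have hdiff : ∀ i j, A (q i - q j) = p i - p j := by
    intro i j
    rw [map_sub, ← hmap i, ← hmap j]; abel
  have hA : ∀ i, A (evec q i) = evec p i := fun i => hdiff _ _
  obtain ⟨B, hAB, hBA⟩ : ∃ B : E2 →L[ℝ] E2, (∀ x, A (B x) = x) ∧ ∀ x, B (A x) = x := by
    let e := LinearMap.equivOfDetNeZero (A : E2 →ₗ[ℝ] E2) hdet.ne'
    have he : ∀ x, e x = A x := fun x => rfl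
    refine ⟨LinearMap.toContinuousLinearMap (e.symm : E2 →ₗ[ℝ] E2), fun x => ?_, fun x => ?_⟩
    · rw [← he]; exact e.apply_symm_apply x
    · rw [← he]; exact e.symm_apply_apply x
  have hB : ∀ i, B (evec p i) = evec q i := fun i => by rw [← hA, hBA]
  have inv := pull_pull hp hq A B hA hAB
  have inv' := pull_pull hq hp B A hB hBA
  refine ⟨fun f g => ⟨fun h => ⟨mem_pull p q A f g h.1, compat_pull hp hq A hA f g h.2⟩,
    fun h => ?_⟩, ?_, ?_, ?_, ?_⟩
  · have h1 := mem_pull q p B f _ h.1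
    have h2 := compat_pull hq hp B hB f _ h.2
    rw [inv] at h1 h2
    exact ⟨h1, h2⟩
  · rintro f g f' g' - - - - rfl h
    rw [← inv f g, h, inv]
  · intro f g h1 h2
    exact ⟨f, pullG q p B f g, mem_pull q p B f g h1, compat_pull hq hp B hB f g h2, rfl, inv' f g⟩
  · intro a f₁ g₁ f₂ g₂ h1 _ h2 _ i t ht
    have d1 : DifferentiableWithinAt ℝ (f₁ i) (Icc 0 1) t :=
      (h1 i).2.1.differentiableOn one_ne_zero t ht
    have d2 : DifferentiableWithinAt ℝ (f₂ i) (Icc 0 1) t :=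
      (h2 i).2.1.differentiableOn one_ne_zero t ht
    have hd : derivWithin (fun s => a * f₁ i s + f₂ i s) (Icc 0 1) t
        = a * derivWithin (f₁ i) (Icc 0 1) t + derivWithin (f₂ i) (Icc 0 1) t :=
      ((d1.hasDerivWithinAt.const_mul a).add d2.hasDerivWithinAt).derivWithin
        (uniqueDiffOn_Icc zero_lt_one t ht)
    simp only [pullG_formula, hd]
    ring
  · intro ζ f g hζ _ _ _ htr i t ht
    have hpt : ∀ s, A (epar q i s) + b = epar p i s := by
      intro s
      rw [epar, epar, map_add, map_smul, hA, ← hmap (i + 1)]; abel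
    have hd : DifferentiableAt ℝ ζ (epar p i t) := hζ.differentiable one_ne_zero _
    refine ⟨by beta_reduce; rw [hpt]; exact (htr i t ht).1, ?_⟩
    have hΦ : HasFDerivAt (fun x => A x + b) A (epar q i t) := A.hasFDerivAt.add_const b
    have hc : HasFDerivAt (fun x => ζ (A x + b)) ((fderiv ℝ ζ (epar p i t)).comp A)
        (epar q i t) :=
      HasFDerivAt.comp (g := ζ) (epar q i t) (by rw [hpt]; exact hd.hasFDerivAt) hΦ
    rw [hc.fderiv]
    have hgrad : ∀ v, fderiv ℝ ζ (epar p i t) v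
        = ⟪(InnerProductSpace.toDual ℝ E2).symm (fderiv ℝ ζ (epar p i t)), v⟫ := fun v => by
      rw [InnerProductSpace.toDual_symm_apply]
    have hG := gfield_eq hp f g i t
      ((InnerProductSpace.toDual ℝ E2).symm (fderiv ℝ ζ (epar p i t)))
      (by
        rw [← hgrad]
        have he : HasDerivAt (fun s => epar p i s) (evec p i) t := by
          have := ((hasDerivAt_id t).smul_const (evec p i)).const_add (p (i + 1))
          simpa [epar] using this
        have h1 : HasDerivAt (fun s => ζ (epar p i s)) (fderiv ℝ ζ (epar p i t) (evec p i)) t :=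
          hd.hasFDerivAt.comp_hasDerivAt t he
        have h2 : HasDerivWithinAt (f i) (fderiv ℝ ζ (epar p i t) (evec p i)) (Icc 0 1) t :=
          h1.hasDerivWithinAt.congr (fun s hs => (htr i s hs).1.symm) (htr i t ht).1.symm
        exact h2.derivWithin (uniqueDiffOn_Icc zero_lt_one t ht))
      (by rw [← hgrad]; exact (htr i t ht).2.symm)
    rw [pullG, hG, ContinuousLinearMap.adjoint_inner_left, ← hgrad]
    rfl
end
end
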